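/- arXiv:2110.13755 — 6 statements merged into one kernel-verified Lean document; each statement's English description precedes it below -/
import Mathlib

section
/- For every x ∈ ℝⁿ, the set 𝒟(x) is the Painlevé–Kuratowski limit of 𝒟ᵗ(x) as t ↓ 0. Explicitly: (a) (outer limit inclusion) if (t_k) is a sequence of positive reals with t_k → 0 and (y_k, u_k) ∈ 𝒟^{t_k}(x) for every k with (y_k, u_k) → (y, u), then (y, u) ∈ 𝒟(x); and (b) (inner limit inclusion) for every (y, u) ∈ 𝒟(x) and every sequence (t_k) of positive reals with t_k → 0 there exist (y_k, u_k) ∈ 𝒟^{t_k}(x) with (y_k, u_k) → (y, u). -/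
open Filter Topology Metric Set

noncomputable section

abbrev Euc (n : ℕ) : Type := EuclideanSpace ℝ (Fin n)

/-- Gradient with respect to the first variable. -/
noncomputable def gradX {n m : ℕ} (h : Euc n × Euc m → ℝ) (x : Euc n) (y : Euc m) : Euc n :=
  gradient (fun x' => h (x', y)) x

/-- Gradient with respect to the second variable. -/
noncomputable def gradY {n m : ℕ} (h : Euc n × Euc m → ℝ) (x : Euc n) (y : Euc m) : Euc m :=
  gradient (fun y' => h (x, y')) y

/-- `ℒ(x,y,u)`: gradient w.r.t. `y` of the lower-level Lagrangian. -/
noncomputable def lagGrad {n m q : ℕ} (f : Euc n × Euc m → ℝ) (g : Fin q → Euc n × Euc m → ℝ)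
    (x : Euc n) (y : Euc m) (u : Euc q) : Euc m :=
  gradY (fun p => f p + ∑ i, u i * g i p) x y

/-- The KKT set-valued map `𝒟(x)`. -/
def DSet {n m q : ℕ} (f : Euc n × Euc m → ℝ) (g : Fin q → Euc n × Euc m → ℝ) (x : Euc n) :
    Set (Euc m × Euc q) :=
  {p | lagGrad f g x p.1 p.2 = 0 ∧
    ∀ i, 0 ≤ p.2 i ∧ g i (x, p.1) ≤ 0 ∧ p.2 i * g i (x, p.1) = 0}

/-- The Scholtes relaxation `𝒟ᵗ(x)`. -/
def DtSet {n m q : ℕ} (f : Euc n × Euc m → ℝ) (g : Fin q → Euc n × Euc m → ℝ) (t : ℝ)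
    (x : Euc n) : Set (Euc m × Euc q) :=
  {p | lagGrad f g x p.1 p.2 = 0 ∧
    ∀ i, 0 ≤ p.2 i ∧ g i (x, p.1) ≤ 0 ∧ -(p.2 i * g i (x, p.1)) ≤ t}

/-- `ψ_p(x)`. -/
noncomputable def psiP {n m q : ℕ} (F f : Euc n × Euc m → ℝ) (g : Fin q → Euc n × Euc m → ℝ)
    (x : Euc n) : ℝ :=
  sSup ((fun p : Euc m × Euc q => F (x, p.1)) '' DSet f g x)

/-- `ψ_pᵗ(x)`. -/
noncomputable def psiPt {n m q : ℕ} (F f : Euc n × Euc m → ℝ) (g : Fin q → Euc n × Euc m → ℝ)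
    (t : ℝ) (x : Euc n) : ℝ :=
  sSup ((fun p : Euc m × Euc q => F (x, p.1)) '' DtSet f g t x)

/-- Maximizer set `S_p(x)`. -/
def SpSet {n m q : ℕ} (F f : Euc n × Euc m → ℝ) (g : Fin q → Euc n × Euc m → ℝ) (x : Euc n) :
    Set (Euc m × Euc q) :=
  {p | p ∈ DSet f g x ∧ ∀ p' ∈ DSet f g x, F (x, p'.1) ≤ F (x, p.1)}

/-- Maximizer set `S_pᵗ(x)`. -/
def SpTSet {n m q : ℕ} (F f : Euc n × Euc m → ℝ) (g : Fin q → Euc n × Euc m → ℝ) (t : ℝ)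
    (x : Euc n) : Set (Euc m × Euc q) :=
  {p | p ∈ DtSet f g t x ∧ ∀ p' ∈ DtSet f g t x, F (x, p'.1) ≤ F (x, p.1)}

/-- Upper-level feasible set `X`. -/
def upperX {n p : ℕ} (G : Fin p → Euc n → ℝ) : Set (Euc n) := {x | ∀ j, G j x ≤ 0}

/-- Upper-level regularity (MFCQ for the upper-level constraints). -/
def UpperLevelRegular {n p : ℕ} (G : Fin p → Euc n → ℝ) (x : Euc n) : Prop :=
  ∀ α : Fin p → ℝ, (∀ j, 0 ≤ α j) → (∀ j, α j * G j x = 0) →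
    (∑ j, α j • gradient (G j) x) = 0 → α = 0

/-- `∇_xℒ_l(x,y,u)`. -/
noncomputable def gradXL {n m q : ℕ} (f : Euc n × Euc m → ℝ) (g : Fin q → Euc n × Euc m → ℝ)
    (x : Euc n) (y : Euc m) (u : Euc q) (l : Fin m) : Euc n :=
  gradX (fun p => lagGrad f g p.1 p.2 u l) x y

/-- `∇_yℒ_l(x,y,u)`. -/
noncomputable def gradYL {n m q : ℕ} (f : Euc n × Euc m → ℝ) (g : Fin q → Euc n × Euc m → ℝ)
    (x : Euc n) (y : Euc m) (u : Euc q) (l : Fin m) : Euc m :=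
  gradY (fun p => lagGrad f g p.1 p.2 u l) x y

/-- The M-multiplier set `Λᵉᵐ(x,y,u,v)`. -/
def LambdaEM {n m q : ℕ} (f : Euc n × Euc m → ℝ) (g : Fin q → Euc n × Euc m → ℝ)
    (x : Euc n) (y : Euc m) (u : Euc q) (v : Euc n × Euc m) :
    Set ((Fin m → ℝ) × (Fin q → ℝ)) :=
  {bg | v + (∑ l, bg.1 l • (gradXL f g x y u l, gradYL f g x y u l))
        + (∑ i, bg.2 i • (gradX (g i) x y, gradY (g i) x y)) = 0 ∧
    (∀ i, 0 < u i ∧ g i (x, y) = 0 → (∑ l, bg.1 l * gradY (g i) x y l) = 0) ∧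
    (∀ i, u i = 0 ∧ g i (x, y) < 0 → bg.2 i = 0) ∧
    (∀ i, u i = 0 ∧ g i (x, y) = 0 →
      (0 < bg.2 i ∧ 0 < ∑ l, bg.1 l * gradY (g i) x y l) ∨
        bg.2 i * (∑ l, bg.1 l * gradY (g i) x y l) = 0)}

/-- The M-multiplier set `Λ_yᵉᵐ(x,y,u,w)`. -/
def LambdaYEM {n m q : ℕ} (f : Euc n × Euc m → ℝ) (g : Fin q → Euc n × Euc m → ℝ)
    (x : Euc n) (y : Euc m) (u : Euc q) (w : Euc m) :
    Set ((Fin m → ℝ) × (Fin q → ℝ)) :=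
  {bg | w + (∑ l, bg.1 l • gradYL f g x y u l) + (∑ i, bg.2 i • gradY (g i) x y) = 0 ∧
    (∀ i, 0 < u i ∧ g i (x, y) = 0 → (∑ l, bg.1 l * gradY (g i) x y l) = 0) ∧
    (∀ i, u i = 0 ∧ g i (x, y) < 0 → bg.2 i = 0) ∧
    (∀ i, u i = 0 ∧ g i (x, y) = 0 →
      (0 < bg.2 i ∧ 0 < ∑ l, bg.1 l * gradY (g i) x y l) ∨
        bg.2 i * (∑ l, bg.1 l * gradY (g i) x y l) = 0)}

/-- Condition `(A₁ᵐ)`. -/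
def A1m {n m q : ℕ} (f : Euc n × Euc m → ℝ) (g : Fin q → Euc n × Euc m → ℝ)
    (x : Euc n) (y : Euc m) (u : Euc q) : Prop :=
  ∀ bg ∈ LambdaEM f g x y u 0, bg.1 = 0 ∧ bg.2 = 0

/-- Condition `(A₂ᵐ)`. -/
def A2m {n m q : ℕ} (f : Euc n × Euc m → ℝ) (g : Fin q → Euc n × Euc m → ℝ)
    (x : Euc n) (y : Euc m) (u : Euc q) : Prop :=
  ∀ bg ∈ LambdaYEM f g x y u 0,
    (∑ l, bg.1 l • gradXL f g x y u l) + (∑ i, bg.2 i • gradX (g i) x y) = 0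

/-- The C-multiplier set `Λᵉᶜ(x,y,u,v)`. -/
def LambdaEC {n m q : ℕ} (f : Euc n × Euc m → ℝ) (g : Fin q → Euc n × Euc m → ℝ)
    (x : Euc n) (y : Euc m) (u : Euc q) (v : Euc n × Euc m) :
    Set ((Fin m → ℝ) × (Fin q → ℝ)) :=
  {bg | v + (∑ l, bg.1 l • (gradXL f g x y u l, gradYL f g x y u l))
        + (∑ i, bg.2 i • (gradX (g i) x y, gradY (g i) x y)) = 0 ∧
    (∀ i, 0 < u i ∧ g i (x, y) = 0 → (∑ l, bg.1 l * gradY (g i) x y l) = 0) ∧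
    (∀ i, u i = 0 ∧ g i (x, y) < 0 → bg.2 i = 0) ∧
    (∀ i, u i = 0 ∧ g i (x, y) = 0 →
      0 ≤ bg.2 i * (∑ l, bg.1 l * gradY (g i) x y l))}

/-- The C-multiplier set `Λ_yᵉᶜ(x,y,u,w)`. -/
def LambdaYEC {n m q : ℕ} (f : Euc n × Euc m → ℝ) (g : Fin q → Euc n × Euc m → ℝ)
    (x : Euc n) (y : Euc m) (u : Euc q) (w : Euc m) :
    Set ((Fin m → ℝ) × (Fin q → ℝ)) :=
  {bg | w + (∑ l, bg.1 l • gradYL f g x y u l) + (∑ i, bg.2 i • gradY (g i) x y) = 0 ∧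
    (∀ i, 0 < u i ∧ g i (x, y) = 0 → (∑ l, bg.1 l * gradY (g i) x y l) = 0) ∧
    (∀ i, u i = 0 ∧ g i (x, y) < 0 → bg.2 i = 0) ∧
    (∀ i, u i = 0 ∧ g i (x, y) = 0 →
      0 ≤ bg.2 i * (∑ l, bg.1 l * gradY (g i) x y l))}

/-- Condition `(A₁ᶜ)`. -/
def A1c {n m q : ℕ} (f : Euc n × Euc m → ℝ) (g : Fin q → Euc n × Euc m → ℝ)
    (x : Euc n) (y : Euc m) (u : Euc q) : Prop :=
  ∀ bg ∈ LambdaEC f g x y u 0, bg.1 = 0 ∧ bg.2 = 0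

/-- Condition `(A₂ᶜ)`. -/
def A2c {n m q : ℕ} (f : Euc n × Euc m → ℝ) (g : Fin q → Euc n × Euc m → ℝ)
    (x : Euc n) (y : Euc m) (u : Euc q) : Prop :=
  ∀ bg ∈ LambdaYEC f g x y u 0,
    (∑ l, bg.1 l • gradXL f g x y u l) + (∑ i, bg.2 i • gradX (g i) x y) = 0

/-- The C-stationarity conditions at `x` with witness `(y,u)` and multipliers `(α,β,γ)`. -/
def CStationaryWith {n m p q : ℕ} (F f : Euc n × Euc m → ℝ) (g : Fin q → Euc n × Euc m → ℝ)
    (G : Fin p → Euc n → ℝ) (x : Euc n) (y : Euc m) (u : Euc q)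
    (α : Fin p → ℝ) (β : Fin m → ℝ) (γ : Fin q → ℝ) : Prop :=
  gradX F x y + (∑ j, α j • gradient (G j) x) + (∑ l, β l • gradXL f g x y u l)
      + (∑ i, γ i • gradX (g i) x y) = 0 ∧
  gradY F x y + (∑ l, β l • gradYL f g x y u l) + (∑ i, γ i • gradY (g i) x y) = 0 ∧
  (∀ j, 0 ≤ α j ∧ G j x ≤ 0 ∧ α j * G j x = 0) ∧
  (∀ i, 0 < u i ∧ g i (x, y) = 0 → (∑ l, β l * gradY (g i) x y l) = 0) ∧
  (∀ i, u i = 0 ∧ g i (x, y) < 0 → γ i = 0) ∧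
  (∀ i, u i = 0 ∧ g i (x, y) = 0 → 0 ≤ γ i * (∑ l, β l * gradY (g i) x y l))

/-- `x` is a C-stationary point. -/
def CStationary {n m p q : ℕ} (F f : Euc n × Euc m → ℝ) (g : Fin q → Euc n × Euc m → ℝ)
    (G : Fin p → Euc n → ℝ) (x : Euc n) : Prop :=
  ∃ y u, (y, u) ∈ SpSet F f g x ∧ ∃ α β γ, CStationaryWith F f g G x y u α β γ

/-- The stationarity system for the relaxed problem with parameter `t`. -/
def RelaxedStationary {n m p q : ℕ} (F f : Euc n × Euc m → ℝ) (g : Fin q → Euc n × Euc m → ℝ)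
    (G : Fin p → Euc n → ℝ) (t : ℝ) (x : Euc n) (y : Euc m) (u : Euc q)
    (α : Fin p → ℝ) (β : Fin m → ℝ) (γ μ δ : Fin q → ℝ) : Prop :=
  (y, u) ∈ SpTSet F f g t x ∧
  gradX F x y + (∑ j, α j • gradient (G j) x) - (∑ l, β l • gradXL f g x y u l)
      - (∑ i, (γ i - δ i * u i) • gradX (g i) x y) = 0 ∧
  gradY F x y - (∑ l, β l • gradYL f g x y u l)
      - (∑ i, (γ i - δ i * u i) • gradY (g i) x y) = 0 ∧
  (∀ i, -(∑ l, β l * gradY (g i) x y l) + μ i + δ i * g i (x, y) = 0) ∧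
  (∀ j, 0 ≤ α j ∧ G j x ≤ 0 ∧ α j * G j x = 0) ∧
  (∀ i, 0 ≤ γ i ∧ g i (x, y) ≤ 0 ∧ γ i * g i (x, y) = 0) ∧
  (∀ i, 0 ≤ μ i ∧ 0 ≤ u i ∧ μ i * u i = 0) ∧
  (∀ i, 0 ≤ δ i ∧ -(u i * g i (x, y)) ≤ t ∧ δ i * (u i * g i (x, y) + t) = 0)

/-- Lower-level optimal solution map `S(x)`. -/
def lowerS {n m q : ℕ} (f : Euc n × Euc m → ℝ) (g : Fin q → Euc n × Euc m → ℝ) (x : Euc n) :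
    Set (Euc m) :=
  {y | (∀ i, g i (x, y) ≤ 0) ∧ ∀ y', (∀ i, g i (x, y') ≤ 0) → f (x, y) ≤ f (x, y')}

/-- Pessimistic value function `φ_p(x)`. -/
noncomputable def phiP {n m q : ℕ} (F f : Euc n × Euc m → ℝ)
    (g : Fin q → Euc n × Euc m → ℝ) (x : Euc n) : ℝ :=
  sSup ((fun y => F (x, y)) '' lowerS f g x)


/-- `Ψ` is Lipschitz-like (Aubin continuous) around `(xb, zb)` with modulus `τ`. -/
def LipschitzLike {n m q : ℕ} (Ψ : Euc n → Set (Euc m × Euc q)) (xb : Euc n)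
    (zb : Euc m × Euc q) (τ : ℝ) : Prop :=
  ∃ U ∈ 𝓝 xb, ∃ V ∈ 𝓝 zb, ∀ x ∈ U, ∀ x' ∈ U, ∀ z ∈ Ψ x ∩ V,
    ∃ z' ∈ Ψ x', dist z z' ≤ τ * dist x x'

/-- `Ψ` is inner semicontinuous at the point `(xb, zb)` of its graph. -/
def InnerSemicontinuousAt {α β : Type*} [TopologicalSpace α] [TopologicalSpace β]
    (Ψ : α → Set β) (xb : α) (zb : β) : Prop :=
  ∀ xk : ℕ → α, Tendsto xk atTop (𝓝 xb) →
    ∃ zk : ℕ → β, (∀ k, zk k ∈ Ψ (xk k)) ∧ Tendsto zk atTop (𝓝 zb)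

theorem continuous_lagGrad {n m q : ℕ} {f : Euc n × Euc m → ℝ} {g : Fin q → Euc n × Euc m → ℝ}
    (hf : ContDiff ℝ 1 f) (hg : ∀ i, ContDiff ℝ 1 (g i)) (x : Euc n) :
    Continuous fun p : Euc m × Euc q => lagGrad f g x p.1 p.2 := by
  have hL : ContDiff ℝ 1 (Function.uncurry fun (p : Euc m × Euc q) (y : Euc m) =>
      f (x, y) + ∑ i, p.2 i * g i (x, y)) := by
    refine ContDiff.add (hf.comp (by fun_prop)) (ContDiff.sum fun i _ => ContDiff.mul ?_ ?_)
    · fun_prop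
    · exact (hg i).comp (by fun_prop)
  exact (InnerProductSpace.toDual ℝ (Euc m)).symm.continuous.comp
    (hL.fderiv (n := 0) contDiff_fst (by norm_num)).continuous

theorem DSet_subset_DtSet {n m q : ℕ} (f : Euc n × Euc m → ℝ) (g : Fin q → Euc n × Euc m → ℝ)
    {t : ℝ} (ht : 0 ≤ t) (x : Euc n) : DSet f g x ⊆ DtSet f g t x := fun _ hp =>
  ⟨hp.1, fun i => ⟨(hp.2 i).1, (hp.2 i).2.1, by rw [(hp.2 i).2.2, neg_zero]; exact ht⟩⟩

theorem mem_DSet_of_tendsto {n m q : ℕ} {f : Euc n × Euc m → ℝ} {g : Fin q → Euc n × Euc m → ℝ}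
    (hf : ContDiff ℝ 1 f) (hg : ∀ i, ContDiff ℝ 1 (g i)) {x : Euc n} {t : ℕ → ℝ}
    {z : ℕ → Euc m × Euc q} {zb : Euc m × Euc q} (ht : Tendsto t atTop (𝓝 0))
    (hz : ∀ k, z k ∈ DtSet f g (t k) x) (hzb : Tendsto z atTop (𝓝 zb)) : zb ∈ DSet f g x := by
  refine ⟨?_, fun i => ?_⟩
  · have h := ((continuous_lagGrad hf hg x).tendsto zb).comp hzb
    exact tendsto_nhds_unique h (tendsto_const_nhds.congr fun k => (hz k).1.symm)
  · have hu : Continuous fun p : Euc m × Euc q => p.2 i := by fun_prop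
    have hgc : Continuous fun p : Euc m × Euc q => g i (x, p.1) :=
      (hg i).continuous.comp (by fun_prop)
    have h1 : 0 ≤ zb.2 i :=
      ge_of_tendsto' ((hu.tendsto zb).comp hzb) fun k => ((hz k).2 i).1
    have h2 : g i (x, zb.1) ≤ 0 :=
      le_of_tendsto' ((hgc.tendsto zb).comp hzb) fun k => ((hz k).2 i).2.1
    have h3 : -(zb.2 i * g i (x, zb.1)) ≤ 0 :=
      le_of_tendsto_of_tendsto' (((hu.mul hgc).neg.tendsto zb).comp hzb) ht
        fun k => ((hz k).2 i).2.2
    exact ⟨h1, h2, le_antisymm (mul_nonpos_of_nonneg_of_nonpos h1 h2) (neg_nonpos.mp h3)⟩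

/-- `𝒟(x)` is the Painlevé–Kuratowski limit of `𝒟ᵗ(x)` as `t ↓ 0`. -/
theorem stmt_3 {n m q : ℕ} (hn : 0 < n) (hm : 0 < m) (hq : 0 < q)
    (f : Euc n × Euc m → ℝ) (g : Fin q → Euc n × Euc m → ℝ)
    (hf : ContDiff ℝ 1 f) (hg : ∀ i, ContDiff ℝ 1 (g i)) :
    ∀ x : Euc n,
      (∀ (t : ℕ → ℝ) (z : ℕ → Euc m × Euc q) (zb : Euc m × Euc q),
        (∀ k, 0 < t k) → Tendsto t atTop (𝓝 0) →
        (∀ k, z k ∈ DtSet f g (t k) x) → Tendsto z atTop (𝓝 zb) →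
        zb ∈ DSet f g x) ∧
      (∀ zb ∈ DSet f g x, ∀ t : ℕ → ℝ, (∀ k, 0 < t k) → Tendsto t atTop (𝓝 0) →
        ∃ z : ℕ → Euc m × Euc q, (∀ k, z k ∈ DtSet f g (t k) x) ∧
          Tendsto z atTop (𝓝 zb)) := by
  intro x
  refine ⟨fun t z zb _ ht hz hzb => mem_DSet_of_tendsto hf hg ht hz hzb,
    fun zb hzb t ht _ => ⟨fun _ => zb, fun k => ?_, tendsto_const_nhds⟩⟩
  exact DSet_subset_DtSet f g (ht k).le x hzb

end
end

section
/- Assume: (i) for every x ∈ X, 𝒟(x) is nonempty and for every t > 0 the set {F(x, y) : (y, u) ∈ 𝒟ᵗ(x)} is bounded above; (ii) ψ_p is lower semicontinuous at x̄, i.e. liminf_{x → x̄} ψ_p(x) ≥ ψ_p(x̄); (iii) for every x ∈ X and every ε > 0 there is α > 0 with ψ_pᵗ(x) ≤ ψ_p(x) + ε for all t ∈ (0, α); (iv) (t_k) is a sequence of positive reals with t_k → 0 and, for each k, x^k ∈ X satisfies ψ_p^{t_k}(x^k) ≤ ψ_p^{t_k}(x) for all x ∈ X; and (v) x^k → x̄.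 Then x̄ ∈ X and ψ_p(x̄) ≤ ψ_p(x) for all x ∈ X, i.e. x̄ is a global optimal solution of the KKT reformulation. -/
open Filter Topology Metric Set

noncomputable section

theorem psiP_le_psiPt {n m q : ℕ} (F f : Euc n × Euc m → ℝ) (g : Fin q → Euc n × Euc m → ℝ)
    {t : ℝ} (ht : 0 ≤ t) {x : Euc n} (hne : (DSet f g x).Nonempty)
    (hbdd : BddAbove ((fun z : Euc m × Euc q => F (x, z.1)) '' DtSet f g t x)) :
    psiP F f g x ≤ psiPt F f g t x :=
  csSup_le_csSup hbdd (hne.image _) (image_mono (DSet_subset_DtSet f g ht x))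

theorem isClosed_upperX {n p : ℕ} {G : Fin p → Euc n → ℝ} (hG : ∀ j, Continuous (G j)) :
    IsClosed (upperX G) := by
  simp only [upperX, Set.ofPred_forall]
  exact isClosed_iInter fun j => isClosed_le (hG j) continuous_const

/-- a limit of global optimal solutions of the relaxed problems is a global
optimal solution of the KKT reformulation. -/
theorem stmt_5 {n m p q : ℕ} (hn : 0 < n) (hm : 0 < m) (hp : 0 < p) (hq : 0 < q)
    (F f : Euc n × Euc m → ℝ) (g : Fin q → Euc n × Euc m → ℝ) (G : Fin p → Euc n → ℝ)
    (hf : ContDiff ℝ 1 f) (hg : ∀ i, ContDiff ℝ 1 (g i)) (hF : ContDiff ℝ 1 F)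
    (hG : ∀ j, ContDiff ℝ 1 (G j))
    (hne : ∀ x ∈ upperX G, (DSet f g x).Nonempty)
    (hbdd : ∀ x ∈ upperX G, ∀ t : ℝ, 0 < t →
      BddAbove ((fun z : Euc m × Euc q => F (x, z.1)) '' DtSet f g t x))
    (xb : Euc n) (hlsc : LowerSemicontinuousAt (psiP F f g) xb)
    (husc : ∀ x ∈ upperX G, ∀ ε > 0, ∃ α > 0, ∀ t : ℝ, 0 < t → t < α →
      psiPt F f g t x ≤ psiP F f g x + ε)
    (t : ℕ → ℝ) (htpos : ∀ k, 0 < t k) (ht0 : Tendsto t atTop (𝓝 0))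
    (xk : ℕ → Euc n) (hxk : ∀ k, xk k ∈ upperX G)
    (hglob : ∀ k, ∀ x ∈ upperX G, psiPt F f g (t k) (xk k) ≤ psiPt F f g (t k) x)
    (hconv : Tendsto xk atTop (𝓝 xb)) :
    xb ∈ upperX G ∧ ∀ x ∈ upperX G, psiP F f g xb ≤ psiP F f g x := by
  refine ⟨(isClosed_upperX fun j => (hG j).continuous).mem_of_tendsto hconv (.of_forall hxk),
    fun x hx => le_of_forall_pos_le_add fun ε hε => ?_⟩
  obtain ⟨α, hα, hle⟩ := husc x hx ε hε
  refine le_of_forall_lt fun c hc => ?_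
  obtain ⟨k, hck, hkα⟩ :=
    ((hconv.eventually (hlsc c hc)).and (ht0.eventually (gt_mem_nhds hα))).exists
  calc c < psiP F f g (xk k) := hck
    _ ≤ psiPt F f g (t k) (xk k) :=
      psiP_le_psiPt F f g (htpos k).le (hne _ (hxk k)) (hbdd _ (hxk k) _ (htpos k))
    _ ≤ psiPt F f g (t k) x := hglob k x hx
    _ ≤ psiP F f g x + ε := hle (t k) (htpos k) hkα

end
end

section
/- Assume: (i) for every x ∈ X, 𝒟(x) is nonempty and for every t > 0 the set {F(x, y) : (y, u) ∈ 𝒟ᵗ(x)} is bounded above; (ii) ψ_p is lower semicontinuous at x̄, i.e. liminf_{x → x̄} ψ_p(x) ≥ ψ_p(x̄); (iii) for every x ∈ X and every ε > 0 there is α > 0 with ψ_pᵗ(x) ≤ ψ_p(x) + ε for all t ∈ (0, α); (iv) (t_k) is a sequence of positive reals with t_k → 0 and, for each k, there is r^k > 0 such that x^k ∈ X satisfies ψ_p^{t_k}(x^k) ≤ ψ_p^{t_k}(x) for all x ∈ X with ‖x − x^k‖ < r^k; (v) liminf_{k→∞} r^k > 0; and (vi) x^k → x̄. Then x̄ ∈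 X and there exists r > 0 such that ψ_p(x̄) ≤ ψ_p(x) for all x ∈ X with ‖x − x̄‖ < r, i.e. x̄ is a local optimal solution of the KKT reformulation. -/
open Filter Topology Metric Set

noncomputable section

/-- a limit of local optimal solutions of the relaxed problems (with radii
uniformly bounded away from zero) is a local optimal solution of the KKT reformulation. -/
theorem stmt_6 {n m p q : ℕ} (hn : 0 < n) (hm : 0 < m) (hp : 0 < p) (hq : 0 < q)
    (F f : Euc n × Euc m → ℝ) (g : Fin q → Euc n × Euc m → ℝ) (G : Fin p → Euc n → ℝ)
    (hf : ContDiff ℝ 1 f) (hg : ∀ i, ContDiff ℝ 1 (g i)) (hF : ContDiff ℝ 1 F)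
    (hG : ∀ j, ContDiff ℝ 1 (G j))
    (hne : ∀ x ∈ upperX G, (DSet f g x).Nonempty)
    (hbdd : ∀ x ∈ upperX G, ∀ t : ℝ, 0 < t →
      BddAbove ((fun z : Euc m × Euc q => F (x, z.1)) '' DtSet f g t x))
    (xb : Euc n) (hlsc : LowerSemicontinuousAt (psiP F f g) xb)
    (husc : ∀ x ∈ upperX G, ∀ ε > 0, ∃ α > 0, ∀ t : ℝ, 0 < t → t < α →
      psiPt F f g t x ≤ psiP F f g x + ε)
    (t : ℕ → ℝ) (htpos : ∀ k, 0 < t k) (ht0 : Tendsto t atTop (𝓝 0))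
    (xk : ℕ → Euc n) (hxk : ∀ k, xk k ∈ upperX G)
    (r : ℕ → ℝ) (hr : ∀ k, 0 < r k)
    (hloc : ∀ k, ∀ x ∈ upperX G, dist x (xk k) < r k →
      psiPt F f g (t k) (xk k) ≤ psiPt F f g (t k) x)
    (hliminf : ∃ c > 0, ∀ᶠ k in atTop, c ≤ r k)
    (hconv : Tendsto xk atTop (𝓝 xb)) :
    xb ∈ upperX G ∧ ∃ ρ > 0, ∀ x ∈ upperX G, dist x xb < ρ →
      psiP F f g xb ≤ psiP F f g x := by
  refine ⟨(isClosed_upperX fun j => (hG j).continuous).mem_of_tendsto hconv (.of_forall hxk), ?_⟩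
  obtain ⟨c, hc, hcr⟩ := hliminf
  refine ⟨c / 2, half_pos hc, fun x hx hxd => le_of_forall_pos_le_add fun ε hε => ?_⟩
  obtain ⟨α, hα, hαt⟩ := husc x hx (ε / 2) (half_pos hε)
  have hlow : ∀ᶠ k in atTop, psiP F f g xb - ε / 2 < psiP F f g (xk k) :=
    hconv.eventually (hlsc _ (sub_lt_self _ (half_pos hε)))
  obtain ⟨k, hk, hck, hdk, htk⟩ := (hlow.and (hcr.and
    ((hconv.eventually (ball_mem_nhds xb (half_pos hc))).and
      (ht0.eventually_lt_const hα)))).exists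
  have hdist : dist x (xk k) < r k := by
    have htri := dist_triangle_right x (xk k) xb
    have hball : dist (xk k) xb < c / 2 := hdk
    linarith
  have h_le := psiP_le_psiPt F f g (htpos k).le (hne _ (hxk k)) (hbdd _ (hxk k) _ (htpos k))
  have h_opt := hloc k x hx hdist
  have h_relax := hαt _ (htpos k) htk
  linarith

end
end

section
/- Assume 𝒟 is lower semicontinuous in the Hausdorff sense at x̄, and the map (t, x) ↦ 𝒟ᵗ(x) is upper semicontinuous at (0, x̄) in the sense that for every ε > 0 there exist α > 0 and δ > 0 such that every point of 𝒟ᵗ(x) lies within distance ε of 𝒟(x̄) whenever t ∈ (0, α) and ‖x − x̄‖ < δ. Then for every ε > 0 there exist a neighborhood U of x̄ and α > 0 such that for all t ∈ (0, α) and all x, x′ ∈ U, every point of 𝒟ᵗ(x) lies within distance ε of 𝒟ᵗ(x′); in particular, for small t > 0 the map 𝒟ᵗ is lower semicontinuous in the Hausdorff sense at every point of U. -/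
open Filter Topology Metric Set

noncomputable section

/-- lower semicontinuity (in Hausdorff sense) of `𝒟ᵗ` near `xb` for small
`t > 0`, from lower semicontinuity of `𝒟` at `xb` and upper semicontinuity of
`(t, x) ↦ 𝒟ᵗ(x)` at `(0, xb)`. -/
theorem stmt_8 {n m q : ℕ} (hn : 0 < n) (hm : 0 < m) (hq : 0 < q)
    (f : Euc n × Euc m → ℝ) (g : Fin q → Euc n × Euc m → ℝ)
    (hf : ContDiff ℝ 1 f) (hg : ∀ i, ContDiff ℝ 1 (g i))
    (xb : Euc n)
    (hlsc : ∀ ε > 0, ∃ δ > 0, ∀ x : Euc n, dist x xb < δ →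
      ∀ z ∈ DSet f g xb, ∃ z' ∈ DSet f g x, dist z z' ≤ ε)
    (husc : ∀ ε > 0, ∃ α > 0, ∃ δ > 0, ∀ t : ℝ, 0 < t → t < α →
      ∀ x : Euc n, dist x xb < δ →
        ∀ z ∈ DtSet f g t x, ∃ z' ∈ DSet f g xb, dist z z' ≤ ε) :
    ∀ ε > 0, ∃ U ∈ 𝓝 xb, ∃ α > 0, ∀ t : ℝ, 0 < t → t < α →
      ∀ x ∈ U, ∀ x' ∈ U, ∀ z ∈ DtSet f g t x, ∃ z' ∈ DtSet f g t x', dist z z' ≤ ε := by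
  intro ε hε
  obtain ⟨δ₁, hδ₁, hl⟩ := hlsc (ε / 2) (half_pos hε)
  obtain ⟨α, hα, δ₂, hδ₂, hu⟩ := husc (ε / 2) (half_pos hε)
  refine ⟨ball xb (min δ₁ δ₂), ball_mem_nhds xb (lt_min hδ₁ hδ₂), α, hα, ?_⟩
  intro t ht htα x hx x' hx' z hz
  obtain ⟨w, hw, hzw⟩ := hu t ht htα x ((mem_ball.1 hx).trans_le (min_le_right _ _)) z hz
  obtain ⟨z', hz', hwz'⟩ := hl x' ((mem_ball.1 hx').trans_le (min_le_left _ _)) w hw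
  exact ⟨z', DSet_subset_DtSet f g ht.le x' hz', by linarith [dist_triangle z w z']⟩

end
end

section
/- Let (t_k) be a sequence of positive reals with t_k → 0 and (x^k) a sequence in ℝⁿ such that for each k there exist (y^k, u^k, α^k, β^k, γ^k, μ^k, δ^k) satisfying the stationarity system for the relaxed problem with parameter t_k at x^k. Assume: x^k → x̄; S_p(x̄) is nonempty and compact; x̄ is upper-level regular; conditions (A₁ᵐ) and (A₂ᵐ) hold at (x̄, y, u) for every (y, u) ∈ S_p(x̄); and sup_{(y,u) ∈ S_p^{t_k}(x^k)} dist((y, u), S_p(x̄)) → 0 as k → ∞ (i.e. for every ε > 0, for all sufficiently large k every (y, u) ∈ S_p^{t_k}(x^k) satisfies dist((y, u), S_p(x̄)) < ε). Then x̄ is a C-stationary point. -/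
open Filter Topology Metric Set

noncomputable section

/-- A function that is affine in each coordinate and does not vanish on the edges of the unit cube
does not vanish on the cube. -/
lemma ne_zero_on_cube_of_ne_zero_on_edges {κ : Type*} [Fintype κ] [DecidableEq κ] [Nonempty κ]
    (φ : (κ → ℝ) → ℝ)
    (haff : ∀ c i τ, φ (Function.update c i τ) =
      (1 - τ) * φ (Function.update c i 0) + τ * φ (Function.update c i 1))
    (hedge : ∀ v : κ → ℝ, (∀ j, v j = 0 ∨ v j = 1) → ∀ i τ, 0 ≤ τ → τ ≤ 1 →
      φ (Function.update v i τ) ≠ 0)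
    (c : κ → ℝ) (hc0 : ∀ i, 0 ≤ c i) (hc1 : ∀ i, c i ≤ 1) : φ c ≠ 0 := by
  have hflip : ∀ v : κ → ℝ, (∀ j, v j = 0 ∨ v j = 1) → ∀ i,
      0 < φ (Function.update v i 0) * φ (Function.update v i 1) := by
    intro v hv i
    by_contra! hle
    set a := φ (Function.update v i 0)
    set b := φ (Function.update v i 1)
    have ha : a ≠ 0 := hedge v hv i 0 le_rfl zero_le_one
    have hab : a - b ≠ 0 := by
      intro h
      have : a = b := by linarith
      rw [← this] at hle
      exact ha (by nlinarith [mul_self_nonneg a])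
    have hkey : a * (a - b) > 0 := by
      have := mul_self_pos.mpr ha
      nlinarith
    have hsq : 0 < (a - b) * (a - b) := mul_self_pos.mpr hab
    have hτ : a / (a - b) = a * (a - b) / ((a - b) * (a - b)) := by field_simp
    refine hedge v hv i (a / (a - b)) ?_ ?_ ?_
    · rw [hτ]; positivity
    · rw [hτ, div_le_one hsq]
      nlinarith [mul_self_nonneg b]
    · rw [haff]
      change (1 - a / (a - b)) * a + a / (a - b) * b = 0
      field_simp
      ring
  have hvert : ∀ s : Finset κ, ∀ v : κ → ℝ, (∀ j, v j = 0 ∨ v j = 1) → (∀ j ∉ s, v j = 0) →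
      0 < φ 0 * φ v := by
    intro s
    induction s using Finset.induction_on with
    | empty =>
      intro v _ hs
      obtain rfl : v = 0 := funext fun j => hs j (Finset.notMem_empty j)
      have := hedge 0 (by simp) (Classical.arbitrary κ) 0 le_rfl zero_le_one
      rw [show Function.update (0 : κ → ℝ) (Classical.arbitrary κ) 0 = 0 from
        Function.update_eq_self _ _] at this
      exact mul_self_pos.mpr this
    | insert i s _ ih =>
      intro v hv hs
      have h0 := ih (Function.update v i 0)
        (fun j => by by_cases h : j = i <;> simp [h, hv])
        (fun j hj => by
          by_cases h : j = i
          · simp [h]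
          · rw [Function.update_of_ne h]
            exact hs j (by simp [h, hj]))
      rcases hv i with h | h
      · rwa [Function.update_eq_self_iff.mpr h.symm] at h0
      · have h1 := hflip v hv i
        rw [show Function.update v i 1 = v from Function.update_eq_self_iff.2 h.symm] at h1
        have h2 : 0 < φ 0 * φ v * (φ (Function.update v i 0) * φ (Function.update v i 0)) := by
          nlinarith [mul_pos h0 h1]
        exact lt_of_not_ge fun h =>
          h2.not_ge (mul_nonpos_of_nonpos_of_nonneg h (mul_self_nonneg _))
  have hall : ∀ s : Finset κ, ∀ c : κ → ℝ, (∀ i, 0 ≤ c i) → (∀ i, c i ≤ 1) →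
      (∀ j ∉ s, c j = 0 ∨ c j = 1) → 0 < φ 0 * φ c := by
    intro s
    induction s using Finset.induction_on with
    | empty =>
      intro c _ _ hs
      exact hvert Finset.univ c (fun j => hs j (Finset.notMem_empty j)) (by simp)
    | insert i s _ ih =>
      intro c hc0 hc1 hs
      have hval : ∀ e : ℝ, e = 0 ∨ e = 1 → 0 < φ 0 * φ (Function.update c i e) := by
        intro e he
        refine ih _ (fun j => ?_) (fun j => ?_) (fun j hj => ?_)
        · rcases he with rfl | rfl <;> by_cases h : j = i <;> simp [h, hc0]
        · rcases he with rfl | rfl <;> by_cases h : j = i <;> simp [h, hc1]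
        · by_cases h : j = i
          · simpa [h] using he
          · rw [Function.update_of_ne h]
            exact hs j (by simp [h, hj])
      have h0 := hval 0 (.inl rfl)
      have h1 := hval 1 (.inr rfl)
      have := haff c i (c i)
      rw [Function.update_eq_self] at this
      rw [this]
      have e0 := hc0 i
      have e1 := hc1 i
      rcases e0.eq_or_lt with h | h
      · rw [← h]; simpa using h0
      · nlinarith [mul_pos h h1, mul_nonneg (sub_nonneg.mpr e1) h0.le]
  intro h
  have := hall Finset.univ c hc0 hc1 (by simp)
  simp [h] at this

/-- If the square systems whose rows are interpolated between `A` and `B` along the edges of the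
unit cube are all regular, then so are those interpolated at any point of the cube. -/
lemma eq_zero_of_interpolated_rows {κ : Type*} [Fintype κ] [DecidableEq κ] [Nonempty κ]
    (A B : Matrix κ κ ℝ)
    (hedge : ∀ v : κ → ℝ, (∀ j, v j = 0 ∨ v j = 1) → ∀ i τ, 0 ≤ τ → τ ≤ 1 → ∀ w : κ → ℝ,
      (∀ j, (1 - Function.update v i τ j) * (A j ⬝ᵥ w) +
        Function.update v i τ j * (B j ⬝ᵥ w) = 0) → w = 0)
    (c : κ → ℝ) (hc0 : ∀ i, 0 ≤ c i) (hc1 : ∀ i, c i ≤ 1) (w : κ → ℝ)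
    (hw : ∀ j, (1 - c j) * (A j ⬝ᵥ w) + c j * (B j ⬝ᵥ w) = 0) : w = 0 := by
  let N : (κ → ℝ) → Matrix κ κ ℝ := fun c => Matrix.of fun j => (1 - c j) • A j + c j • B j
  have hN : ∀ c w, (N c).mulVec w = 0 ↔
      ∀ j, (1 - c j) * (A j ⬝ᵥ w) + c j * (B j ⬝ᵥ w) = 0 := by
    intro c w
    rw [funext_iff]
    refine forall_congr' fun j => ?_
    change ((1 - c j) • A j + c j • B j) ⬝ᵥ w = 0 ↔ _
    rw [add_dotProduct, smul_dotProduct, smul_dotProduct, smul_eq_mul, smul_eq_mul]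
  have hdet : ∀ c, (N c).det ≠ 0 ↔ ∀ w, (N c).mulVec w = 0 → w = 0 := by
    intro c
    rw [Ne, ← Matrix.exists_mulVec_eq_zero_iff]
    push Not
    exact forall_congr' fun w => not_imp_not
  have hup : ∀ c i τ, N (Function.update c i τ) =
      (N c).updateRow i ((1 - τ) • A i + τ • B i) := by
    intro c i τ
    ext j k
    by_cases h : j = i
    · subst h; simp [N]
    · simp [N, h]
  have hmain := ne_zero_on_cube_of_ne_zero_on_edges (fun c => (N c).det) ?_ ?_ c hc0 hc1
  · exact (hdet c).1 hmain w ((hN c w).2 hw)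
  · intro c i τ
    simp only [hup, Matrix.det_updateRow_add, Matrix.det_updateRow_smul]
    ring
  · intro v hv i τ h0 h1
    exact (hdet _).2 fun w h => hedge v hv i τ h0 h1 w ((hN _ w).1 h)

/-- For square complementarity systems, absence of nontrivial abnormal multipliers of Mordukhovich
type implies absence of nontrivial abnormal multipliers of Clarke type. -/
lemma clarke_abnormal_eq_zero {m q : ℕ} (hm : 0 < m) (L : Fin m → Fin m → ℝ)
    (d : Fin q → Fin m → ℝ) (θ ν : Fin q → Prop)
    (hM : ∀ (β : Fin m → ℝ) (γ : Fin q → ℝ),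
      (∀ k, ∑ l, β l * L l k + ∑ i, γ i * d i k = 0) →
      (∀ i, ¬ θ i → ν i → ∑ l, β l * d i l = 0) → (∀ i, ¬ θ i → ¬ ν i → γ i = 0) →
      (∀ i, θ i → (0 < γ i ∧ 0 < ∑ l, β l * d i l) ∨ γ i * ∑ l, β l * d i l = 0) →
      β = 0 ∧ γ = 0)
    (β : Fin m → ℝ) (γ : Fin q → ℝ)
    (heq : ∀ k, ∑ l, β l * L l k + ∑ i, γ i * d i k = 0)
    (hν : ∀ i, ¬ θ i → ν i → ∑ l, β l * d i l = 0) (hη : ∀ i, ¬ θ i → ¬ ν i → γ i = 0)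
    (hθ : ∀ i, θ i → 0 ≤ γ i * ∑ l, β l * d i l) : β = 0 ∧ γ = 0 := by
  classical
  have : Nonempty (Fin m ⊕ Fin q) := ⟨.inl ⟨0, hm⟩⟩
  let T : Fin m → Fin m ⊕ Fin q → ℝ := fun k => Sum.elim (fun l => L l k) (fun i => d i k)
  let a : Fin q → Fin m ⊕ Fin q → ℝ := fun i => Pi.single (.inr i) 1
  let b : Fin q → Fin m ⊕ Fin q → ℝ := fun i => Sum.elim (d i) 0
  let A : Matrix (Fin m ⊕ Fin q) (Fin m ⊕ Fin q) ℝ :=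
    Sum.elim T fun i => if θ i then a i else if ν i then b i else a i
  let B : Matrix (Fin m ⊕ Fin q) (Fin m ⊕ Fin q) ℝ :=
    Sum.elim T fun i => if θ i then -b i else if ν i then b i else a i
  have hT : ∀ k (β : Fin m → ℝ) (γ : Fin q → ℝ),
      T k ⬝ᵥ Sum.elim β γ = ∑ l, β l * L l k + ∑ i, γ i * d i k := by
    intro k β γ
    simp [T, dotProduct, mul_comm]
  have ha : ∀ i (β : Fin m → ℝ) (γ : Fin q → ℝ), a i ⬝ᵥ Sum.elim β γ = γ i := by
    intro i β γ
    simp [a]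
  have hb : ∀ i (β : Fin m → ℝ) (γ : Fin q → ℝ),
      b i ⬝ᵥ Sum.elim β γ = ∑ l, β l * d i l := by
    intro i β γ
    simp [b, dotProduct, mul_comm]
  have hedge : ∀ v : Fin m ⊕ Fin q → ℝ, (∀ j, v j = 0 ∨ v j = 1) → ∀ i τ, 0 ≤ τ → τ ≤ 1 →
      ∀ w : Fin m ⊕ Fin q → ℝ, (∀ j, (1 - Function.update v i τ j) * (A j ⬝ᵥ w) +
        Function.update v i τ j * (B j ⬝ᵥ w) = 0) → w = 0 := by
    intro v hv i₀ τ h0 h1 w hw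
    obtain ⟨β, γ, rfl⟩ : ∃ β γ, w = Sum.elim β γ := ⟨_, _, (Sum.elim_comp_inl_inr w).symm⟩
    have e1 : ∀ k, ∑ l, β l * L l k + ∑ i, γ i * d i k = 0 := by
      intro k
      have := hw (.inl k)
      simp only [A, B, Sum.elim_inl, hT] at this
      linarith
    have e2 : ∀ i, ¬ θ i → ν i → ∑ l, β l * d i l = 0 := by
      intro i hi hi'
      have := hw (.inr i)
      simp only [A, B, Sum.elim_inr, hi, hi', if_true, if_false, hb] at this
      linarith
    have e3 : ∀ i, ¬ θ i → ¬ ν i → γ i = 0 := by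
      intro i hi hi'
      have := hw (.inr i)
      simp only [A, B, Sum.elim_inr, hi, hi', if_false, ha] at this
      linarith
    have e4 : ∀ i, θ i → (1 - Function.update v i₀ τ (.inr i)) * γ i =
        Function.update v i₀ τ (.inr i) * ∑ l, β l * d i l := by
      intro i hi
      have := hw (.inr i)
      simp only [A, B, Sum.elim_inr, hi, if_true, neg_dotProduct, ha, hb] at this
      linarith
    have e5 : ∀ i, θ i → Sum.inr i ≠ i₀ → γ i * ∑ l, β l * d i l = 0 := by
      intro i hi hne
      have := e4 i hi
      rw [Function.update_of_ne hne] at this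
      rcases hv (.inr i) with h | h <;> rw [h] at this
      · rw [show γ i = 0 by linarith, zero_mul]
      · rw [show ∑ l, β l * d i l = 0 by linarith, mul_zero]
    by_cases hneg : ∃ i, θ i ∧ Sum.inr i = i₀ ∧ γ i < 0 ∧ ∑ l, β l * d i l < 0
    · obtain ⟨i₁, -, rfl, hγ, hβ⟩ := hneg
      have := hM (-β) (-γ) (fun k => by have := e1 k; simp [Finset.sum_neg_distrib]; linarith)
        (fun i hi hi' => by simp [e2 i hi hi']) (fun i hi hi' => by simp [e3 i hi hi'])
        (fun i hi => by
          by_cases h : i = i₁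
          · subst h
            left
            simp [hγ, hβ]
          · right
            simpa using e5 i hi (by simpa using h))
      rw [neg_eq_zero.1 this.1, neg_eq_zero.1 this.2]
      ext (j | j) <;> rfl
    · have := hM β γ e1 e2 e3 (fun i hi => by
        by_cases h : Sum.inr i = i₀
        · by_contra hcon
          push Not at hcon
          obtain ⟨hcon, hne⟩ := hcon
          have h4 := e4 i hi
          rw [h, Function.update_self] at h4
          obtain ⟨hγ, hβ⟩ := mul_ne_zero_iff.1 hne
          have hnn : 0 ≤ γ i * ∑ l, β l * d i l := by
            rcases h0.eq_or_lt with h0 | h0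
            · rw [← h0] at h4
              exact absurd (by linarith) hγ
            · have h5 : τ * (γ i * ∑ l, β l * d i l) = (1 - τ) * (γ i * γ i) := by
                linear_combination -γ i * h4
              refine nonneg_of_mul_nonneg_right (h5 ▸ ?_) h0
              exact mul_nonneg (by linarith) (mul_self_nonneg _)
          have hpos := lt_of_le_of_ne hnn (Ne.symm hne)
          rcases pos_and_pos_or_neg_and_neg_of_mul_pos hpos with h | h'
          · exact absurd h.2 (not_lt.2 (hcon h.1))
          · exact hneg ⟨i, hi, h, h'⟩
        · exact .inr (e5 i hi h))
      rw [this.1, this.2]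
      ext (j | j) <;> rfl
  let c : Fin m ⊕ Fin q → ℝ :=
    Sum.elim 0 fun i => if θ i then γ i / (γ i + ∑ l, β l * d i l) else 0
  have hcθ : ∀ i, θ i → 0 ≤ c (.inr i) ∧ c (.inr i) ≤ 1 ∧
      (1 - c (.inr i)) * γ i = c (.inr i) * ∑ l, β l * d i l := by
    intro i hi
    simp only [c, Sum.elim_inr, hi, if_true]
    have hnn := hθ i hi
    set x := γ i
    set z := ∑ l, β l * d i l
    by_cases hxz : x + z = 0
    · have hx : x = 0 := by nlinarith
      simp [hx]
    · have hsq : 0 < (x + z) * (x + z) := mul_self_pos.mpr hxz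
      have hfrac : x / (x + z) = x * (x + z) / ((x + z) * (x + z)) := by field_simp
      refine ⟨?_, ?_, ?_⟩
      · rw [hfrac]
        exact div_nonneg (by nlinarith) hsq.le
      · rw [hfrac, div_le_one hsq]
        nlinarith
      · field_simp
        ring
  have hc : ∀ j, 0 ≤ c j ∧ c j ≤ 1 := by
    rintro (j | j)
    · simp [c]
    · by_cases h : θ j
      · exact ⟨(hcθ j h).1, (hcθ j h).2.1⟩
      · simp [c, h]
  have hzero := eq_zero_of_interpolated_rows A B hedge c (fun j => (hc j).1) (fun j => (hc j).2)
    (Sum.elim β γ) (by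
      rintro (j | j)
      · simp only [A, B, Sum.elim_inl, hT, heq j]
        simp
      · by_cases h : θ j
        · simp only [A, B, Sum.elim_inr, h, if_true, neg_dotProduct, ha, hb]
          linarith [(hcθ j h).2.2]
        · by_cases h' : ν j
          · simp [A, B, h, h', hb, hν j h h']
          · simp [A, B, h, h', ha, hη j h h'])
  exact ⟨funext fun l => congrFun hzero (.inl l), funext fun i => congrFun hzero (.inr i)⟩

lemma DSet_multiplier_eq_zero {n m q : ℕ} (hm : 0 < m) {f : Euc n × Euc m → ℝ}
    {g : Fin q → Euc n × Euc m → ℝ} {x : Euc n} {z : Euc m × Euc q} (hz : z ∈ DSet f g x)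
    (h1 : A1m f g x z.1 z.2) (h2 : A2m f g x z.1 z.2) {bg : (Fin m → ℝ) × (Fin q → ℝ)}
    (hbg : bg ∈ LambdaYEC f g x z.1 z.2 0) : bg.1 = 0 ∧ bg.2 = 0 := by
  have hM : ∀ bg ∈ LambdaYEM f g x z.1 z.2 0, bg.1 = 0 ∧ bg.2 = 0 := by
    intro bg hbg
    refine h1 bg ⟨?_, hbg.2⟩
    have hx := h2 bg hbg
    have hy := hbg.1
    rw [zero_add] at hy ⊢
    ext1
    · simpa [Prod.fst_sum] using hx
    · simpa [Prod.snd_sum] using hy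
  have hiff : ∀ (β : Fin m → ℝ) (γ : Fin q → ℝ),
      0 + (∑ l, β l • gradYL f g x z.1 z.2 l) + (∑ i, γ i • gradY (g i) x z.1) = 0 ↔
      ∀ k, ∑ l, β l * gradYL f g x z.1 z.2 l k + ∑ i, γ i * gradY (g i) x z.1 k = 0 := by
    intro β γ
    rw [zero_add, PiLp.ext_iff]
    simp
  have hpos : ∀ i, ¬ (z.2 i = 0 ∧ g i (x, z.1) = 0) → g i (x, z.1) = 0 → 0 < z.2 i :=
    fun i h h' => lt_of_le_of_ne (hz.2 i).1 fun h0 => h ⟨h0.symm, h'⟩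
  have hneg : ∀ i, ¬ g i (x, z.1) = 0 → z.2 i = 0 ∧ g i (x, z.1) < 0 :=
    fun i h => ⟨(mul_eq_zero.1 (hz.2 i).2.2).resolve_right h, lt_of_le_of_ne (hz.2 i).2.1 h⟩
  obtain ⟨heq, hν, hη, hθ⟩ := hbg
  refine clarke_abnormal_eq_zero hm (fun l k => gradYL f g x z.1 z.2 l k)
    (fun i k => gradY (g i) x z.1 k) (fun i => z.2 i = 0 ∧ g i (x, z.1) = 0)
    (fun i => g i (x, z.1) = 0) ?_ bg.1 bg.2 ((hiff _ _).1 heq)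
    (fun i hi hi' => hν i ⟨hpos i hi hi', hi'⟩) (fun i _ hi' => hη i (hneg i hi')) hθ
  intro β γ heq hν hη hθ
  exact hM (β, γ) ⟨(hiff _ _).2 heq, fun i hi => hν i (fun h => hi.1.ne' h.1) hi.2,
    fun i hi => hη i (fun h => hi.2.ne h.2) hi.2.ne, hθ⟩

lemma ContDiff.gradient_fst {E P : Type*} [NormedAddCommGroup E] [InnerProductSpace ℝ E]
    [CompleteSpace E] [NormedAddCommGroup P] [NormedSpace ℝ P] {k l : WithTop ℕ∞}
    {H : E × P → ℝ} (hH : ContDiff ℝ k H) (hl : l + 1 ≤ k) :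
    ContDiff ℝ l fun z : E × P => gradient (fun x => H (x, z.2)) z.1 := by
  refine (InnerProductSpace.toDual ℝ E).symm.contDiff.comp ?_
  refine ContDiff.fderiv (f := fun (z : E × P) x => H (x, z.2)) (g := fun z => z.1) ?_
    contDiff_fst hl
  exact hH.comp (contDiff_snd.prodMk (contDiff_snd.comp contDiff_fst))

lemma continuous_gradX {n m : ℕ} {h : Euc n × Euc m → ℝ} (hh : ContDiff ℝ 1 h) :
    Continuous fun z : Euc n × Euc m => gradX h z.1 z.2 :=
  (hh.gradient_fst (l := 0) (by norm_num)).continuous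

lemma contDiff_gradY {n m : ℕ} {h : Euc n × Euc m → ℝ} {k l : WithTop ℕ∞}
    (hh : ContDiff ℝ k h) (hl : l + 1 ≤ k) :
    ContDiff ℝ l fun z : Euc n × Euc m => gradY h z.1 z.2 :=
  (ContDiff.gradient_fst (H := fun z : Euc m × Euc n => h (z.2, z.1))
    (hh.comp (contDiff_snd.prodMk contDiff_fst)) hl).comp (contDiff_snd.prodMk contDiff_fst)

lemma continuous_gradY {n m : ℕ} {h : Euc n × Euc m → ℝ} (hh : ContDiff ℝ 1 h) :
    Continuous fun z : Euc n × Euc m => gradY h z.1 z.2 :=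
  (contDiff_gradY hh (l := 0) (by norm_num)).continuous

lemma contDiff_lagGrad {n m q : ℕ} {f : Euc n × Euc m → ℝ} {g : Fin q → Euc n × Euc m → ℝ}
    (hf : ContDiff ℝ 2 f) (hg : ∀ i, ContDiff ℝ 2 (g i)) :
    ContDiff ℝ 1 fun z : Euc n × Euc m × Euc q => lagGrad f g z.1 z.2.1 z.2.2 := by
  have hH : ContDiff ℝ 2 fun w : Euc m × Euc n × Euc q =>
      f (w.2.1, w.1) + ∑ i, w.2.2 i * g i (w.2.1, w.1) := by
    have hswap : ContDiff ℝ 2 fun w : Euc m × Euc n × Euc q => (w.2.1, w.1) := by fun_prop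
    refine (hf.comp hswap).add (ContDiff.sum fun i _ => ContDiff.mul ?_ ((hg i).comp hswap))
    fun_prop
  exact (hH.gradient_fst (l := 1) (by norm_num)).comp
    (g := fun w : Euc m × Euc n × Euc q => gradient (fun y => f (w.2.1, y) +
      ∑ i, w.2.2 i * g i (w.2.1, y)) w.1)
    (f := fun z : Euc n × Euc m × Euc q => (z.2.1, z.1, z.2.2)) (by fun_prop)

lemma continuous_gradXL {n m q : ℕ} {f : Euc n × Euc m → ℝ} {g : Fin q → Euc n × Euc m → ℝ}
    (hf : ContDiff ℝ 2 f) (hg : ∀ i, ContDiff ℝ 2 (g i)) (l : Fin m) :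
    Continuous fun z : Euc n × Euc m × Euc q => gradXL f g z.1 z.2.1 z.2.2 l := by
  have h : ContDiff ℝ 1 fun z : Euc n × Euc m × Euc q => lagGrad f g z.1 z.2.1 z.2.2 l :=
    contDiff_euclidean.1 (contDiff_lagGrad hf hg) l
  exact (h.gradient_fst (l := 0) (by norm_num)).continuous

lemma continuous_gradYL {n m q : ℕ} {f : Euc n × Euc m → ℝ} {g : Fin q → Euc n × Euc m → ℝ}
    (hf : ContDiff ℝ 2 f) (hg : ∀ i, ContDiff ℝ 2 (g i)) (l : Fin m) :
    Continuous fun z : Euc n × Euc m × Euc q => gradYL f g z.1 z.2.1 z.2.2 l := by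
  have h : ContDiff ℝ 1 fun z : Euc n × Euc m × Euc q => lagGrad f g z.1 z.2.1 z.2.2 l :=
    contDiff_euclidean.1 (contDiff_lagGrad hf hg) l
  have h' : ContDiff ℝ 1 fun w : Euc m × Euc n × Euc q => lagGrad f g w.2.1 w.1 w.2.2 l :=
    h.comp (g := fun z : Euc n × Euc m × Euc q => lagGrad f g z.1 z.2.1 z.2.2 l)
      (f := fun w : Euc m × Euc n × Euc q => (w.2.1, w.1, w.2.2)) (by fun_prop)
  exact (h'.gradient_fst (l := 0) (by norm_num)).continuous.comp
    (f := fun z : Euc n × Euc m × Euc q => (z.2.1, z.1, z.2.2)) (by fun_prop)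

/-- The homogenized C-stationarity system, with weight `s` on the objective and the complementarity
of `u` with `g` not yet imposed. -/
def homogenizedSystem {n m p q : ℕ} (F f : Euc n × Euc m → ℝ) (g : Fin q → Euc n × Euc m → ℝ)
    (G : Fin p → Euc n → ℝ) :
    Set ((Euc n × Euc m × Euc q) × ℝ × (Fin p → ℝ) × (Fin m → ℝ) × (Fin q → ℝ)) :=
  {w | w.2.1 • gradX F w.1.1 w.1.2.1 + (∑ j, w.2.2.1 j • gradient (G j) w.1.1)
        - (∑ l, w.2.2.2.1 l • gradXL f g w.1.1 w.1.2.1 w.1.2.2 l)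
        - (∑ i, w.2.2.2.2 i • gradX (g i) w.1.1 w.1.2.1) = 0 ∧
    w.2.1 • gradY F w.1.1 w.1.2.1
        - (∑ l, w.2.2.2.1 l • gradYL f g w.1.1 w.1.2.1 w.1.2.2 l)
        - (∑ i, w.2.2.2.2 i • gradY (g i) w.1.1 w.1.2.1) = 0 ∧
    0 ≤ w.2.1 ∧
    (∀ j, 0 ≤ w.2.2.1 j ∧ G j w.1.1 ≤ 0 ∧ w.2.2.1 j * G j w.1.1 = 0) ∧
    (∀ i, (∑ l, w.2.2.2.1 l * gradY (g i) w.1.1 w.1.2.1 l) * w.1.2.2 i +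
      w.2.2.2.2 i * g i (w.1.1, w.1.2.1) = 0) ∧
    (∀ i, 0 ≤ w.2.2.2.2 i * ∑ l, w.2.2.2.1 l * gradY (g i) w.1.1 w.1.2.1 l)}

lemma isClosed_homogenizedSystem {n m p q : ℕ} {F f : Euc n × Euc m → ℝ}
    {g : Fin q → Euc n × Euc m → ℝ} {G : Fin p → Euc n → ℝ}
    (hf : ContDiff ℝ 2 f) (hg : ∀ i, ContDiff ℝ 2 (g i))
    (hF : ContDiff ℝ 1 F) (hG : ∀ j, ContDiff ℝ 1 (G j)) :
    IsClosed (homogenizedSystem F f g G) := by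
  have hg1 : ∀ i, ContDiff ℝ 1 (g i) := fun i => (hg i).of_le (by norm_num)
  let W := (Euc n × Euc m × Euc q) × ℝ × (Fin p → ℝ) × (Fin m → ℝ) × (Fin q → ℝ)
  have hxy : Continuous fun w : W => (w.1.1, w.1.2.1) := by fun_prop
  have cFx : Continuous fun w : W => gradX F w.1.1 w.1.2.1 := (continuous_gradX hF).comp hxy
  have cFy : Continuous fun w : W => gradY F w.1.1 w.1.2.1 := (continuous_gradY hF).comp hxy
  have cgx : ∀ i, Continuous fun w : W => gradX (g i) w.1.1 w.1.2.1 :=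
    fun i => (continuous_gradX (hg1 i)).comp hxy
  have cgy : ∀ i, Continuous fun w : W => gradY (g i) w.1.1 w.1.2.1 :=
    fun i => (continuous_gradY (hg1 i)).comp hxy
  have cg : ∀ i, Continuous fun w : W => g i (w.1.1, w.1.2.1) :=
    fun i => (hg i).continuous.comp hxy
  have cLx : ∀ l, Continuous fun w : W => gradXL f g w.1.1 w.1.2.1 w.1.2.2 l :=
    fun l => (continuous_gradXL hf hg l).comp continuous_fst
  have cLy : ∀ l, Continuous fun w : W => gradYL f g w.1.1 w.1.2.1 w.1.2.2 l :=
    fun l => (continuous_gradYL hf hg l).comp continuous_fst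
  have cG : ∀ j, Continuous fun w : W => G j w.1.1 :=
    fun j => (hG j).continuous.comp (by fun_prop)
  have cG' : ∀ j, Continuous fun w : W => gradient (G j) w.1.1 := fun j =>
    (InnerProductSpace.toDual ℝ (Euc n)).symm.continuous.comp
      (((hG j).continuous_fderiv one_ne_zero).comp (by fun_prop))
  simp only [homogenizedSystem, ofPred_and, ofPred_forall]
  refine .inter (isClosed_eq (by fun_prop) (by fun_prop)) <|
    .inter (isClosed_eq (by fun_prop) (by fun_prop)) <|
    .inter (isClosed_le (by fun_prop) (by fun_prop)) <|
    .inter (isClosed_iInter fun j => .inter (isClosed_le (by fun_prop) (by fun_prop)) <|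
      .inter (isClosed_le (by fun_prop) (by fun_prop)) (isClosed_eq (by fun_prop) (by fun_prop))) <|
    .inter (isClosed_iInter fun i => isClosed_eq (by fun_prop) (by fun_prop)) <|
    isClosed_iInter fun i => isClosed_le (by fun_prop) (by fun_prop)

lemma smul_mem_homogenizedSystem {n m p q : ℕ} {F f : Euc n × Euc m → ℝ}
    {g : Fin q → Euc n × Euc m → ℝ} {G : Fin p → Euc n → ℝ} {z : Euc n × Euc m × Euc q}
    {v : ℝ × (Fin p → ℝ) × (Fin m → ℝ) × (Fin q → ℝ)} (h : (z, v) ∈ homogenizedSystem F f g G)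
    {r : ℝ} (hr : 0 ≤ r) : (z, r • v) ∈ homogenizedSystem F f g G := by
  obtain ⟨h1, h2, h3, h4, h5, h6⟩ := h
  have hsum : ∀ i, ∑ l, (r • v).2.2.1 l * gradY (g i) z.1 z.2.1 l =
      r * ∑ l, v.2.2.1 l * gradY (g i) z.1 z.2.1 l := fun i => by
    simp [Finset.mul_sum, mul_assoc]
  refine ⟨?_, ?_, mul_nonneg hr h3, fun j => ⟨mul_nonneg hr (h4 j).1, (h4 j).2.1, ?_⟩,
    fun i => ?_, fun i => ?_⟩
  · simpa [Finset.smul_sum, smul_add, smul_sub, smul_smul] using congrArg (r • ·) h1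
  · simpa [Finset.smul_sum, smul_sub, smul_smul] using congrArg (r • ·) h2
  · change r * v.2.1 j * G j z.1 = 0
    rw [mul_assoc, (h4 j).2.2, mul_zero]
  · change (∑ l, (r • v).2.2.1 l * gradY (g i) z.1 z.2.1 l) * z.2.2 i +
      r * v.2.2.2 i * g i (z.1, z.2.1) = 0
    rw [hsum]
    linear_combination r * h5 i
  · change 0 ≤ r * v.2.2.2 i * ∑ l, (r • v).2.2.1 l * gradY (g i) z.1 z.2.1 l
    rw [hsum]
    have := mul_nonneg (mul_nonneg hr hr) (h6 i)
    linarith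

lemma RelaxedStationary.mem_homogenizedSystem {n m p q : ℕ} {F f : Euc n × Euc m → ℝ}
    {g : Fin q → Euc n × Euc m → ℝ} {G : Fin p → Euc n → ℝ} {t : ℝ} {x : Euc n} {y : Euc m}
    {u : Euc q} {α : Fin p → ℝ} {β : Fin m → ℝ} {γ μ δ : Fin q → ℝ} (ht : 0 ≤ t)
    (h : RelaxedStationary F f g G t x y u α β γ μ δ) :
    ((x, y, u), (1 : ℝ), α, β, fun i => γ i - δ i * u i) ∈ homogenizedSystem F f g G := by
  obtain ⟨-, h1, h2, h3, h4, h5, h6, h7⟩ := h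
  have hsum : ∀ i, ∑ l, β l * gradY (g i) x y l = μ i + δ i * g i (x, y) :=
    fun i => by linarith [h3 i]
  refine ⟨by simpa using h1, by simpa using h2, zero_le_one, h4, fun i => ?_, fun i => ?_⟩
  · change (∑ l, β l * gradY (g i) x y l) * u i + (γ i - δ i * u i) * g i (x, y) = 0
    rw [hsum]
    linear_combination (h5 i).2.2 + (h6 i).2.2
  · change 0 ≤ (γ i - δ i * u i) * ∑ l, β l * gradY (g i) x y l
    rw [hsum]
    have e : (γ i - δ i * u i) * (μ i + δ i * g i (x, y)) = γ i * μ i + δ i * δ i * t := by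
      linear_combination δ i * (h5 i).2.2 - δ i * (h6 i).2.2 - δ i * (h7 i).2.2
    rw [e]
    exact add_nonneg (mul_nonneg (h5 i).1 (h6 i).1) (mul_nonneg (mul_self_nonneg _) ht)

lemma IsCompact.exists_tendsto_subseq_of_dist {E : Type*} [MetricSpace E] {S : Set E}
    (hS : IsCompact S) {w : ℕ → E}
    (hw : ∀ ε > 0, ∀ᶠ k in atTop, ∃ z ∈ S, dist (w k) z < ε) :
    ∃ a ∈ S, ∃ φ : ℕ → ℕ, StrictMono φ ∧ Tendsto (w ∘ φ) atTop (𝓝 a) := by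
  have hne : S.Nonempty := by
    obtain ⟨k, z, hz, -⟩ := (hw 1 one_pos).exists
    exact ⟨z, hz⟩
  choose z hzS hz using fun k => hS.exists_infDist_eq_dist hne (w k)
  have hdist : Tendsto (fun k => dist (w k) (z k)) atTop (𝓝 0) := by
    rw [Metric.tendsto_atTop']
    intro ε hε
    obtain ⟨N, hN⟩ := eventually_atTop.1 (hw ε hε)
    refine ⟨N, fun k hk => ?_⟩
    obtain ⟨z', hz', hlt⟩ := hN k hk.le
    rw [Real.dist_0_eq_abs, abs_of_nonneg dist_nonneg, ← hz k]
    exact (infDist_le_dist_of_mem hz').trans_lt hlt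
  obtain ⟨a, ha, φ, hφ, hlim⟩ := hS.tendsto_subseq hzS
  refine ⟨a, ha, φ, hφ, hlim.congr_dist ?_⟩
  simpa [Function.comp_def, dist_comm] using hdist.comp hφ.tendsto_atTop

/-- convergence of stationary points of the relaxed problems to a
C-stationary point. -/
theorem stmt_11 {n m p q : ℕ} (hn : 0 < n) (hm : 0 < m) (hp : 0 < p) (hq : 0 < q)
    (F f : Euc n × Euc m → ℝ) (g : Fin q → Euc n × Euc m → ℝ) (G : Fin p → Euc n → ℝ)
    (hf : ContDiff ℝ 2 f) (hg : ∀ i, ContDiff ℝ 2 (g i))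
    (hF : ContDiff ℝ 1 F) (hG : ∀ j, ContDiff ℝ 1 (G j))
    (t : ℕ → ℝ) (htpos : ∀ k, 0 < t k) (ht0 : Tendsto t atTop (𝓝 0))
    (xk : ℕ → Euc n)
    (hstat : ∀ k, ∃ y u α β γ μ δ,
      RelaxedStationary F f g G (t k) (xk k) y u α β γ μ δ)
    (xb : Euc n) (hconv : Tendsto xk atTop (𝓝 xb))
    (hSne : (SpSet F f g xb).Nonempty) (hScomp : IsCompact (SpSet F f g xb))
    (hreg : UpperLevelRegular G xb)
    (hA : ∀ z ∈ SpSet F f g xb, A1m f g xb z.1 z.2 ∧ A2m f g xb z.1 z.2)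
    (hdist : ∀ ε > 0, ∀ᶠ k in atTop, ∀ z ∈ SpTSet F f g (t k) (xk k),
      ∃ z' ∈ SpSet F f g xb, dist z z' < ε) :
    CStationary F f g G xb := by
  choose y u α β γ μ δ hrel using hstat
  obtain ⟨z, hzS, φ, hφ, hz⟩ := hScomp.exists_tendsto_subseq_of_dist
    (w := fun k => (y k, u k)) fun ε hε => (hdist ε hε).mono fun k hk => hk _ (hrel k).1
  let v : ℕ → ℝ × (Fin p → ℝ) × (Fin m → ℝ) × (Fin q → ℝ) :=
    fun k => (1, α k, β k, fun i => γ k i - δ k i * u k i)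
  have hv : ∀ k, ‖v k‖ ≠ 0 := fun k h => one_ne_zero (congrArg Prod.fst (norm_eq_zero.1 h))
  obtain ⟨w, hw, ψ, hψ, hlim⟩ := (isCompact_sphere
    (0 : ℝ × (Fin p → ℝ) × (Fin m → ℝ) × (Fin q → ℝ)) 1).tendsto_subseq
    (x := fun k => ‖v (φ k)‖⁻¹ • v (φ k)) fun k => by simp [norm_smul, hv]
  have hmem : ((xb, z), w) ∈ homogenizedSystem F f g G := by
    refine (isClosed_homogenizedSystem hf hg hF hG).mem_of_tendsto
      (((hconv.comp (hφ.comp hψ).tendsto_atTop).prodMk_nhds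
        (hz.comp hψ.tendsto_atTop)).prodMk_nhds hlim) (Eventually.of_forall fun k => ?_)
    exact smul_mem_homogenizedSystem ((hrel (φ (ψ k))).mem_homogenizedSystem (htpos _).le)
      (inv_nonneg.2 (norm_nonneg _))
  obtain ⟨yb, ub⟩ := z
  obtain ⟨s, a, b, c⟩ := w
  obtain ⟨h1, h2, hs, h4, h5, h6⟩ := hmem
  dsimp only at h1 h2 hs h4 h5 h6
  have hν : ∀ i, 0 < ub i ∧ g i (xb, yb) = 0 → ∑ l, b l * gradY (g i) xb yb l = 0 := by
    intro i hi
    have := h5 i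
    rw [hi.2, mul_zero, add_zero] at this
    exact (mul_eq_zero.1 this).resolve_right hi.1.ne'
  have hη : ∀ i, ub i = 0 ∧ g i (xb, yb) < 0 → c i = 0 := by
    intro i hi
    have := h5 i
    rw [hi.1, mul_zero, zero_add] at this
    exact (mul_eq_zero.1 this).resolve_right hi.2.ne
  rcases hs.eq_or_lt with rfl | hs
  · exfalso
    obtain ⟨hb, hc⟩ := DSet_multiplier_eq_zero hm hzS.1 (hA _ hzS).1 (hA _ hzS).2
      (bg := (b, c)) ⟨by
        rw [zero_smul, zero_sub, ← neg_add', neg_eq_zero] at h2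
        rwa [zero_add], hν, hη, fun i _ => h6 i⟩
    dsimp only at hb hc
    subst hb hc
    have ha : a = 0 := hreg a (fun j => (h4 j).1) (fun j => (h4 j).2.2) (by simpa using h1)
    subst ha
    simp at hw
  · have hsum : ∀ i, ∑ l, (-s⁻¹ • b) l * gradY (g i) xb yb l =
        -s⁻¹ * ∑ l, b l * gradY (g i) xb yb l := fun i => by
      simp only [Finset.mul_sum, Pi.smul_apply, smul_eq_mul, mul_assoc]
    have hinv : 0 < s⁻¹ := inv_pos.2 hs
    refine ⟨yb, ub, hzS, s⁻¹ • a, -s⁻¹ • b, -s⁻¹ • c, ?_, ?_, fun j =>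
      ⟨mul_nonneg hinv.le (h4 j).1, (h4 j).2.1, ?_⟩, fun i hi => ?_, fun i hi => ?_, fun i _ => ?_⟩
    · have := congrArg (s⁻¹ • ·) h1
      simpa [smul_add, smul_sub, Finset.smul_sum, smul_smul, hs.ne', sub_eq_add_neg] using this
    · have := congrArg (s⁻¹ • ·) h2
      simpa [smul_sub, Finset.smul_sum, smul_smul, hs.ne', sub_eq_add_neg] using this
    · rw [Pi.smul_apply, smul_eq_mul, mul_assoc, (h4 j).2.2, mul_zero]
    · rw [hsum, hν i hi, mul_zero]
    · rw [Pi.smul_apply, hη i hi, smul_zero]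
    · rw [hsum, Pi.smul_apply, smul_eq_mul]
      have := mul_nonneg (mul_nonneg hinv.le hinv.le) (h6 i)
      linarith

end
end

section
/- Let x̄ be upper-level regular and suppose conditions (A₁ᵐ) and (A₂ᵐ) hold at (x̄, ȳ, ū) with (ȳ, ū) ∈ 𝒟(x̄). Then there exist a neighborhood U × V of (x̄, (ȳ, ū)) and α₀ > 0 such that for every t ∈ (0, α₀), every x ∈ U ∩ X and every (y, u) ∈ V ∩ 𝒟ᵗ(x): (a) x is upper-level regular; and (b) the qualification condition (CQ1) holds at (x, y, u) for parameter t: whenever (β, γ, δ, μ) ∈ ℝᵐ × ℝ^q × ℝ^q × ℝ^q satisfy ∑_l β_l ∇_yℒ_l(x,y,u) + ∑_i (γ_i − δ_i u_i) ∇_y g_i(x,y) = 0, ⟨β, ∇_y g_i(x,y)⟩ − μ_i − δ_i g_i(x,y) = 0 for all i, γ ≥ 0, δ ≥ 0, μ ≥ 0, and μ_i u_i = 0, γ_i g_i(x,y) = 0, δ_i (u_i g_i(x,y) + t) = 0 for all i, then β = 0 and γ = δ = μ = 0. -/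
open Filter Topology Metric Set

noncomputable section

/-- Mixed multipliers and a symmetric matrix: if the system `H β + Jᵀ γ = 0` has only the trivial
solution of mixed type for the index sets `Z` (where `J β` vanishes), `T` (biactive) and the rest
(where `γ` vanishes), then `∑ γ_j (J β)_j < 0` for each of its nonzero solutions. -/
theorem sum_mul_mulVec_neg_of_isSymm {m q : ℕ} (H : Matrix (Fin m) (Fin m) ℝ) (hH : H.IsSymm)
    (J : Matrix (Fin q) (Fin m) ℝ) (T : Finset (Fin q)) :
    ∀ Z : Finset (Fin q), Disjoint T Z →
    (∀ (β : Fin m → ℝ) (γ : Fin q → ℝ), H.mulVec β + J.transpose.mulVec γ = 0 →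
      (∀ j ∈ Z, J.mulVec β j = 0) → (∀ j, j ∉ T → j ∉ Z → γ j = 0) →
      (∀ j ∈ T, (0 < γ j ∧ 0 < J.mulVec β j) ∨ γ j * J.mulVec β j = 0) → β = 0 ∧ γ = 0) →
    ∀ (β : Fin m → ℝ) (γ : Fin q → ℝ), H.mulVec β + J.transpose.mulVec γ = 0 →
      (∀ j ∈ Z, J.mulVec β j = 0) → (∀ j, j ∉ T → j ∉ Z → γ j = 0) →
      (β = 0 ∧ γ = 0) ∨ ∑ j, γ j * J.mulVec β j < 0 := by
  have key : ∀ (β β' : Fin m → ℝ) (γ : Fin q → ℝ), H.mulVec β + J.transpose.mulVec γ = 0 →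
      β' ⬝ᵥ H.mulVec β = - ∑ j, γ j * J.mulVec β' j := by
    intro β β' γ h
    have h1 : β' ⬝ᵥ (H.mulVec β + J.transpose.mulVec γ) = 0 := by rw [h]; simp
    rw [dotProduct_add, Matrix.mulVec_transpose, dotProduct_comm β' (Matrix.vecMul γ J),
      ← Matrix.dotProduct_mulVec] at h1
    simp only [dotProduct] at h1 ⊢
    linarith
  induction T using Finset.induction_on with
  | empty =>
    intro Z _ hM β γ h1 h2 h3
    exact Or.inl (hM β γ h1 h2 h3 (by simp))
  | insert i S hi ih =>
    intro Z hd hM β γ h1 h2 h3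
    have hiZ : i ∉ Z := by
      rw [Finset.disjoint_left] at hd; exact hd (Finset.mem_insert_self i S)
    have hdS : ∀ j ∈ S, j ∉ Z := fun j hj => by
      rw [Finset.disjoint_left] at hd; exact hd (Finset.mem_insert_of_mem hj)
    have IH := ih (insert i Z) (by
      rw [Finset.disjoint_left]
      intro j hj hj'
      rcases Finset.mem_insert.1 hj' with rfl | h
      · exact hi hj
      · exact hdS j hj h) (by
      intro β γ e1 e2 e3 e4
      refine hM β γ e1 (fun j hj => e2 j (Finset.mem_insert_of_mem hj)) (fun j hj hj' => e3 j ?_ ?_)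
        (fun j hj => ?_)
      · exact fun h => hj (Finset.mem_insert_of_mem h)
      · intro h
        rcases Finset.mem_insert.1 h with rfl | h
        · exact hj (Finset.mem_insert_self _ _)
        · exact hj' h
      · rcases Finset.mem_insert.1 hj with rfl | h
        · right; rw [e2 j (Finset.mem_insert_self _ _), mul_zero]
        · exact e4 j h)
    -- a nonzero solution whose only free complementarity pair is the one indexed by `i`
    obtain ⟨b, c, hbc, e1, e2, e3⟩ : ∃ (b : Fin m → ℝ) (c : Fin q → ℝ), ¬ (b = 0 ∧ c = 0) ∧
        H.mulVec b + J.transpose.mulVec c = 0 ∧ (∀ j ∈ Z, J.mulVec b j = 0) ∧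
        (∀ j, j ≠ i → j ∉ Z → c j = 0) := by
      let L : ((Fin m → ℝ) × (Fin q → ℝ)) →ₗ[ℝ] ((Fin m → ℝ) × (Fin q → ℝ)) :=
        { toFun := fun w => (H.mulVec w.1 + J.transpose.mulVec w.2,
            fun j => if j = i then 0 else if j ∈ Z then J.mulVec w.1 j else w.2 j)
          map_add' := by
            intro v w
            ext j
            · simp [Matrix.mulVec_add]; ring
            · simp only [Prod.fst_add, Prod.snd_add, Matrix.mulVec_add, Pi.add_apply]
              split_ifs <;> simp
          map_smul' := by
            intro r w
            ext j
            · simp [Matrix.mulVec_smul]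
            · simp only [Prod.smul_fst, Prod.smul_snd, Matrix.mulVec_smul, Pi.smul_apply,
                RingHom.id_apply]
              split_ifs <;> simp }
      have hns : ¬ Function.Surjective L := by
        intro hs
        obtain ⟨w, hw⟩ := hs (0, fun _ => 1)
        have := congrFun (congrArg Prod.snd hw) i
        simp [L] at this
      rw [← LinearMap.injective_iff_surjective, injective_iff_map_eq_zero] at hns
      push Not at hns
      obtain ⟨w, hw, hw0⟩ := hns
      refine ⟨w.1, w.2, fun h => hw0 (Prod.ext h.1 h.2), congrArg Prod.fst hw, ?_, ?_⟩
      · intro j hj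
        have := congrFun (congrArg Prod.snd hw) j
        have hji : j ≠ i := by rintro rfl; exact hiZ hj
        simpa [L, hji, hj] using this
      · intro j hji hj
        have := congrFun (congrArg Prod.snd hw) j
        simpa [L, hji, hj] using this
    have hneg : c i * J.mulVec b i < 0 := by
      by_contra hge
      rw [not_lt] at hge
      have hS : ∀ j ∈ S, c j = 0 := fun j hj =>
        e3 j (by rintro rfl; exact hi hj) (hdS j hj)
      have hout : ∀ j, j ∉ insert i S → j ∉ Z → c j = 0 := fun j hj hj' =>
        e3 j (by rintro rfl; exact hj (Finset.mem_insert_self _ _)) hj'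
      rcases hge.eq_or_lt with h0 | hpos
      · apply hbc
        refine hM b c e1 e2 hout fun j hj => Or.inr ?_
        rcases Finset.mem_insert.1 hj with rfl | h
        · exact h0.symm
        · rw [hS j h, zero_mul]
      · rcases mul_pos_iff.1 hpos with hp | hp
        · apply hbc
          refine hM b c e1 e2 hout fun j hj => ?_
          rcases Finset.mem_insert.1 hj with rfl | h
          · exact Or.inl hp
          · right; rw [hS j h, zero_mul]
        · have := hM (-b) (-c) (by rw [Matrix.mulVec_neg, Matrix.mulVec_neg, ← neg_add, e1, neg_zero])
            (fun j hj => by rw [Matrix.mulVec_neg, Pi.neg_apply, e2 j hj, neg_zero])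
            (fun j hj hj' => by rw [Pi.neg_apply, hout j hj hj', neg_zero]) (fun j hj => by
              rcases Finset.mem_insert.1 hj with rfl | h
              · left
                rw [Matrix.mulVec_neg, Pi.neg_apply, Pi.neg_apply]
                exact ⟨neg_pos.2 hp.1, neg_pos.2 hp.2⟩
              · right; rw [Pi.neg_apply, hS j h, neg_zero, zero_mul])
          exact hbc ⟨neg_eq_zero.1 this.1, neg_eq_zero.1 this.2⟩
    have hξ : J.mulVec b i ≠ 0 := right_ne_zero_of_mul hneg.ne
    set r := J.mulVec β i / J.mulVec b i with hr
    have f1 : H.mulVec (β - r • b) + J.transpose.mulVec (γ - r • c) = 0 := by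
      rw [Matrix.mulVec_sub, Matrix.mulVec_sub, Matrix.mulVec_smul, Matrix.mulVec_smul,
        sub_add_sub_comm, ← smul_add, h1, e1, smul_zero, sub_zero]
    have f2 : ∀ j ∈ insert i Z, J.mulVec (β - r • b) j = 0 := by
      intro j hj
      rw [Matrix.mulVec_sub, Matrix.mulVec_smul, Pi.sub_apply, Pi.smul_apply, smul_eq_mul]
      rcases Finset.mem_insert.1 hj with rfl | h
      · rw [hr, div_mul_cancel₀ _ hξ, sub_self]
      · rw [h2 j h, e2 j h, mul_zero, sub_zero]
    have f3 : ∀ j, j ∉ S → j ∉ insert i Z → (γ - r • c) j = 0 := by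
      intro j hj hj'
      rw [Finset.mem_insert, not_or] at hj'
      simp [h3 j (by simp [hj, hj'.1]) hj'.2, e3 j hj'.1 hj'.2]
    have hc : ∑ j, c j * J.mulVec b j = c i * J.mulVec b i := by
      refine Finset.sum_eq_single i (fun j _ hji => ?_) (by simp)
      by_cases hj : j ∈ Z
      · rw [e2 j hj, mul_zero]
      · rw [e3 j hji hj, zero_mul]
    have hcross : ∑ j, c j * J.mulVec (β - r • b) j = 0 := by
      refine Finset.sum_eq_zero fun j _ => ?_
      by_cases hj : j ∈ insert i Z
      · rw [f2 j hj, mul_zero]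
      · rw [Finset.mem_insert, not_or] at hj
        rw [e3 j hj.1 hj.2, zero_mul]
    set β₀ := β - r • b with hβ₀
    set γ₀ := γ - r • c with hγ₀
    have hβ : β = β₀ + r • b := by rw [hβ₀, sub_add_cancel]
    have hγ : γ = γ₀ + r • c := by rw [hγ₀, sub_add_cancel]
    have k2 : ∑ j, γ₀ j * J.mulVec b j = 0 := by
      have s1 := key β₀ b γ₀ f1
      have s2 := key b β₀ c e1
      have s3 : b ⬝ᵥ H.mulVec β₀ = β₀ ⬝ᵥ H.mulVec b := by
        rw [Matrix.dotProduct_mulVec, ← Matrix.mulVec_transpose, hH.eq, dotProduct_comm]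
      linarith
    have hsum : ∑ j, γ j * J.mulVec β j =
        ∑ j, γ₀ j * J.mulVec β₀ j + r ^ 2 * (c i * J.mulVec b i) := by
      have : ∑ j, γ j * J.mulVec β j = ∑ j, γ₀ j * J.mulVec β₀ j
          + r * ∑ j, γ₀ j * J.mulVec b j + r * ∑ j, c j * J.mulVec β₀ j
          + r ^ 2 * ∑ j, c j * J.mulVec b j := by
        simp only [Finset.mul_sum, ← Finset.sum_add_distrib]
        refine Finset.sum_congr rfl fun j _ => ?_
        rw [hβ, hγ, Matrix.mulVec_add, Matrix.mulVec_smul]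
        simp only [Pi.add_apply, Pi.smul_apply, smul_eq_mul]
        ring
      rw [this, k2, hcross, hc]; ring
    rcases eq_or_ne r 0 with h0 | h0
    · have := IH β₀ γ₀ f1 f2 f3
      rw [hsum, h0]
      rw [hβ, hγ, h0]
      simpa using this
    · right
      have hr2 : r ^ 2 * (c i * J.mulVec b i) < 0 := mul_neg_of_pos_of_neg (by positivity) hneg
      rcases IH β₀ γ₀ f1 f2 f3 with ⟨hb0, hc0⟩ | hlt
      · rw [hsum, hc0]; simpa using hr2
      · linarith

/-- A closed family of cones which is trivial at a point is trivial near that point. -/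
theorem eventually_cone_trivial {S W : Type*} [TopologicalSpace S] [NormedAddCommGroup W]
    [NormedSpace ℝ W] [ProperSpace W] {C : Set (S × W)} (hC : IsClosed C)
    (hcone : ∀ s w (c : ℝ), 0 < c → (s, w) ∈ C → (s, c • w) ∈ C) (s₀ : S)
    (h₀ : ∀ w, (s₀, w) ∈ C → w = 0) :
    ∀ᶠ s in 𝓝 s₀, ∀ w, (s, w) ∈ C → w = 0 := by
  have h : ∀ᶠ s in 𝓝 s₀, ∀ w ∈ sphere (0 : W) 1, (s, w) ∉ C := by
    refine (isCompact_sphere (0 : W) 1).eventually_forall_of_forall_eventually fun w hw => ?_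
    refine hC.isOpen_compl.mem_nhds (x := (s₀, w)) fun hmem => ?_
    rw [h₀ w hmem] at hw
    simp at hw
  filter_upwards [h] with s hs w hw
  by_contra hne
  have hpos : 0 < ‖w‖ := norm_pos_iff.2 hne
  refine hs (‖w‖⁻¹ • w) ?_ (hcone s w _ (inv_pos.2 hpos) hw)
  rw [mem_sphere_zero_iff_norm, norm_smul, norm_inv, norm_norm, inv_mul_cancel₀ hpos.ne']

theorem gradient_apply {n : ℕ} (h : Euc n → ℝ) (x : Euc n) (l : Fin n) :
    gradient h x l = fderiv ℝ h x (EuclideanSpace.single l 1) := by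
  have : inner ℝ (gradient h x) (EuclideanSpace.single l (1 : ℝ)) = gradient h x l := by
    rw [EuclideanSpace.inner_single_right]
    simp
  rw [← this, gradient, InnerProductSpace.toDual_symm_apply]

theorem gradY_apply {n m : ℕ} {h : Euc n × Euc m → ℝ} (hd : Differentiable ℝ h) (x : Euc n)
    (y : Euc m) (l : Fin m) :
    gradY h x y l = fderiv ℝ h (x, y) (0, EuclideanSpace.single l 1) := by
  have h1 : HasFDerivAt (fun y' : Euc m => h (x, y'))
      ((fderiv ℝ h (x, y)).comp (ContinuousLinearMap.inr ℝ (Euc n) (Euc m))) y :=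
    (hd (x, y)).hasFDerivAt.comp y (hasFDerivAt_prodMk_right x y)
  rw [gradY, gradient_apply, h1.fderiv]
  rfl

theorem lagGrad_apply {n m q : ℕ} {f : Euc n × Euc m → ℝ} {g : Fin q → Euc n × Euc m → ℝ}
    (hf : Differentiable ℝ f) (hg : ∀ i, Differentiable ℝ (g i)) (x : Euc n) (y : Euc m)
    (u : Euc q) (l : Fin m) :
    lagGrad f g x y u l = fderiv ℝ f (x, y) (0, EuclideanSpace.single l 1)
      + ∑ i, u i * fderiv ℝ (g i) (x, y) (0, EuclideanSpace.single l 1) := by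
  have hd : HasFDerivAt (fun p => f p + ∑ i, u i * g i p)
      (fderiv ℝ f (x, y) + ∑ i, u i • fderiv ℝ (g i) (x, y)) (x, y) :=
    (hf _).hasFDerivAt.add (HasFDerivAt.fun_sum fun i _ => ((hg i _).hasFDerivAt.const_mul (u i)))
  rw [lagGrad, gradY_apply (by fun_prop), hd.fderiv]
  simp

theorem gradYL_apply {n m q : ℕ} {f : Euc n × Euc m → ℝ} {g : Fin q → Euc n × Euc m → ℝ}
    (hf : ContDiff ℝ 2 f) (hg : ∀ i, ContDiff ℝ 2 (g i)) (x : Euc n) (y : Euc m)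
    (u : Euc q) (l k : Fin m) :
    gradYL f g x y u l k =
      fderiv ℝ (fderiv ℝ f) (x, y) (0, EuclideanSpace.single k 1) (0, EuclideanSpace.single l 1)
      + ∑ i, u i * fderiv ℝ (fderiv ℝ (g i)) (x, y) (0, EuclideanSpace.single k 1)
          (0, EuclideanSpace.single l 1) := by
  have hd2 : ∀ h : Euc n × Euc m → ℝ, ContDiff ℝ 2 h → Differentiable ℝ (fderiv ℝ h) :=
    fun h hh => (hh.fderiv_right (m := 1) (by norm_num)).differentiable (by norm_num)
  have hf2 := hd2 f hf
  have hg2 := fun i => hd2 (g i) (hg i)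
  have hfun : (fun p : Euc n × Euc m => lagGrad f g p.1 p.2 u l) = fun p =>
      fderiv ℝ f p (0, EuclideanSpace.single l 1)
        + ∑ i, u i * fderiv ℝ (g i) p (0, EuclideanSpace.single l 1) := by
    funext p
    exact lagGrad_apply (hf.differentiable (by norm_num))
      (fun i => (hg i).differentiable (by norm_num)) p.1 p.2 u l
  have hev : ∀ (h : Euc n × Euc m → ℝ), Differentiable ℝ (fderiv ℝ h) → ∀ v,
      HasFDerivAt (fun p => fderiv ℝ h p v) ((fderiv ℝ (fderiv ℝ h) (x, y)).flip v) (x, y) := by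
    intro h hh v
    simpa using (hh (x, y)).hasFDerivAt.clm_apply (hasFDerivAt_const v (x, y))
  have hd := (hev f hf2 (0, EuclideanSpace.single l 1)).add (HasFDerivAt.fun_sum (u := Finset.univ)
    fun i _ => ((hev (g i) (hg2 i) (0, EuclideanSpace.single l 1)).const_mul (u i)))
  rw [gradYL, hfun, gradY_apply (by fun_prop)]
  erw [hd.fderiv]
  simp

theorem continuous_gradY_apply {n m : ℕ} {h : Euc n × Euc m → ℝ} (hh : ContDiff ℝ 2 h)
    (l : Fin m) : Continuous fun p : Euc n × Euc m => gradY h p.1 p.2 l := by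
  have hc : Continuous (fderiv ℝ h) := hh.continuous_fderiv (by norm_num)
  simp_rw [gradY_apply (hh.differentiable (by norm_num))]
  exact hc.clm_apply continuous_const

theorem continuous_gradYL_apply {n m q : ℕ} {f : Euc n × Euc m → ℝ}
    {g : Fin q → Euc n × Euc m → ℝ} (hf : ContDiff ℝ 2 f) (hg : ∀ i, ContDiff ℝ 2 (g i))
    (l k : Fin m) :
    Continuous fun s : Euc n × Euc m × Euc q => gradYL f g s.1 s.2.1 s.2.2 l k := by
  have hc : ∀ h : Euc n × Euc m → ℝ, ContDiff ℝ 2 h → Continuous (fderiv ℝ (fderiv ℝ h)) :=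
    fun h hh => (hh.fderiv_right (m := 1) (by norm_num)).continuous_fderiv (by norm_num)
  have hc' : ∀ h : Euc n × Euc m → ℝ, ContDiff ℝ 2 h → ∀ v w, Continuous
      fun s : Euc n × Euc m × Euc q => fderiv ℝ (fderiv ℝ h) (s.1, s.2.1) v w := fun h hh v w =>
    (((hc h hh).comp (g := fderiv ℝ (fderiv ℝ h)) (f := fun s : Euc n × Euc m × Euc q =>
      (s.1, s.2.1)) (by fun_prop)).clm_apply continuous_const).clm_apply continuous_const
  simp_rw [gradYL_apply hf hg]
  refine (hc' f hf _ _).add (continuous_finsetSum _ fun i _ => Continuous.mul ?_ (hc' _ (hg i) _ _))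
  fun_prop

theorem gradYL_symm {n m q : ℕ} {f : Euc n × Euc m → ℝ} {g : Fin q → Euc n × Euc m → ℝ}
    (hf : ContDiff ℝ 2 f) (hg : ∀ i, ContDiff ℝ 2 (g i)) (x : Euc n) (y : Euc m)
    (u : Euc q) (l k : Fin m) : gradYL f g x y u l k = gradYL f g x y u k l := by
  have hs : ∀ h : Euc n × Euc m → ℝ, ContDiff ℝ 2 h → IsSymmSndFDerivAt ℝ h (x, y) :=
    fun h hh => hh.contDiffAt.isSymmSndFDerivAt (by simp)
  rw [gradYL_apply hf hg, gradYL_apply hf hg, (hs f hf).eq]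
  congr 1
  exact Finset.sum_congr rfl fun i _ => by rw [(hs _ (hg i)).eq]

theorem UpperLevelRegular.eventually {n p : ℕ} {G : Fin p → Euc n → ℝ}
    (hG : ∀ j, ContDiff ℝ 1 (G j)) {xb : Euc n} (hreg : UpperLevelRegular G xb) :
    ∀ᶠ x in 𝓝 xb, UpperLevelRegular G x := by
  have hgrad : ∀ j, Continuous (gradient (G j)) := fun j =>
    (LinearIsometryEquiv.continuous _).comp ((hG j).continuous_fderiv (by norm_num))
  have hGc : ∀ j, Continuous (G j) := fun j => (hG j).continuous
  let C : Set (Euc n × (Fin p → ℝ)) := {w | (∀ j, 0 ≤ w.2 j) ∧ (∀ j, w.2 j * G j w.1 = 0) ∧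
    (∑ j, w.2 j • gradient (G j) w.1) = 0}
  have hC : IsClosed C := by
    simp only [C, ofPred_and, ofPred_forall]
    refine (isClosed_iInter fun j => isClosed_le ?_ ?_).inter
      ((isClosed_iInter fun j => isClosed_eq ?_ ?_).inter (isClosed_eq ?_ ?_)) <;> fun_prop
  have := eventually_cone_trivial hC (by
    rintro x α c hc ⟨h1, h2, h3⟩
    refine ⟨fun j => mul_nonneg hc.le (h1 j), fun j => ?_, ?_⟩
    · simp only [Pi.smul_apply, smul_eq_mul, mul_assoc]
      rw [h2 j, mul_zero]
    · simp only [Pi.smul_apply, smul_assoc]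
      rw [← Finset.smul_sum, h3, smul_zero]) xb (fun α h => hreg α h.1 h.2.1 h.2.2)
  filter_upwards [this] with x hx α h1 h2 h3
  exact hx α ⟨h1, h2, h3⟩

/-- Base points `(x, y, u)` together with multipliers `(β, γ)` solving the `y`-part of the multiplier
equation, such that `⟨β, ∇_y g_i⟩ u_i + γ_i g_i = 0` and `γ_i ⟨β, ∇_y g_i⟩ ≥ 0` for all `i`. -/
def signedMultipliers {n m q : ℕ} (f : Euc n × Euc m → ℝ) (g : Fin q → Euc n × Euc m → ℝ) :
    Set ((Euc n × Euc m × Euc q) × ((Fin m → ℝ) × (Fin q → ℝ))) :=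
  {p | (∑ l, p.2.1 l • gradYL f g p.1.1 p.1.2.1 p.1.2.2 l)
        + (∑ i, p.2.2 i • gradY (g i) p.1.1 p.1.2.1) = 0 ∧
    ∀ i, (∑ l, p.2.1 l * gradY (g i) p.1.1 p.1.2.1 l) * p.1.2.2 i
        + p.2.2 i * g i (p.1.1, p.1.2.1) = 0 ∧
      0 ≤ p.2.2 i * ∑ l, p.2.1 l * gradY (g i) p.1.1 p.1.2.1 l}

theorem isClosed_signedMultipliers {n m q : ℕ} {f : Euc n × Euc m → ℝ}
    {g : Fin q → Euc n × Euc m → ℝ} (hf : ContDiff ℝ 2 f) (hg : ∀ i, ContDiff ℝ 2 (g i)) :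
    IsClosed (signedMultipliers f g) := by
  have hY : ∀ i l, Continuous fun p : (Euc n × Euc m × Euc q) × ((Fin m → ℝ) × (Fin q → ℝ)) =>
      gradY (g i) p.1.1 p.1.2.1 l := fun i l => (continuous_gradY_apply (hg i) l).comp
    (by fun_prop : Continuous fun p : (Euc n × Euc m × Euc q) × ((Fin m → ℝ) × (Fin q → ℝ)) =>
      (p.1.1, p.1.2.1))
  have hYL : ∀ l k, Continuous fun p : (Euc n × Euc m × Euc q) × ((Fin m → ℝ) × (Fin q → ℝ)) =>
      gradYL f g p.1.1 p.1.2.1 p.1.2.2 l k := fun l k =>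
    (continuous_gradYL_apply hf hg l k).comp continuous_fst
  have hgc : ∀ i, Continuous (g i) := fun i => (hg i).continuous
  simp only [signedMultipliers, PiLp.ext_iff, ofPred_and, ofPred_forall, PiLp.add_apply,
    WithLp.ofLp_sum, Finset.sum_apply, PiLp.smul_apply, smul_eq_mul]
  have hβ : ∀ l, Continuous fun p : (Euc n × Euc m × Euc q) × ((Fin m → ℝ) × (Fin q → ℝ)) =>
      p.2.1 l := by fun_prop
  have hγ : ∀ i, Continuous fun p : (Euc n × Euc m × Euc q) × ((Fin m → ℝ) × (Fin q → ℝ)) =>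
      p.2.2 i := by fun_prop
  have hξ : ∀ i, Continuous fun p : (Euc n × Euc m × Euc q) × ((Fin m → ℝ) × (Fin q → ℝ)) =>
      ∑ l, p.2.1 l * gradY (g i) p.1.1 p.1.2.1 l := fun i =>
    continuous_finsetSum _ fun l _ => (hβ l).mul (hY i l)
  refine (isClosed_iInter fun k => isClosed_eq ?_ continuous_const).inter
    (isClosed_iInter fun i => (isClosed_eq ?_ continuous_const).inter
      (isClosed_le continuous_const ((hγ i).mul (hξ i))))
  · exact (continuous_finsetSum _ fun l _ => (hβ l).mul (hYL l k)).add
      (continuous_finsetSum _ fun i _ => (hγ i).mul (hY i k))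
  · exact ((hξ i).mul (by fun_prop)).add ((hγ i).mul (by fun_prop))

theorem smul_mem_signedMultipliers {n m q : ℕ} {f : Euc n × Euc m → ℝ}
    {g : Fin q → Euc n × Euc m → ℝ} (s : Euc n × Euc m × Euc q) (w : (Fin m → ℝ) × (Fin q → ℝ))
    (c : ℝ) (h : (s, w) ∈ signedMultipliers f g) : (s, c • w) ∈ signedMultipliers f g := by
  obtain ⟨h1, h2⟩ := h
  refine ⟨?_, fun i => ?_⟩
  · simp only [Prod.smul_fst, Prod.smul_snd, Pi.smul_apply, smul_assoc]
    rw [← Finset.smul_sum, ← Finset.smul_sum, ← smul_add]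
    simp only at h1
    rw [h1, smul_zero]
  · obtain ⟨h3, h4⟩ := h2 i
    simp only [Prod.smul_fst, Prod.smul_snd, Pi.smul_apply, smul_eq_mul, mul_assoc,
      ← Finset.mul_sum] at h3 h4 ⊢
    refine ⟨by rw [← mul_add, h3, mul_zero], ?_⟩
    have := mul_nonneg (mul_self_nonneg c) h4
    linarith

theorem signedMultipliers_trivial {n m q : ℕ} {f : Euc n × Euc m → ℝ}
    {g : Fin q → Euc n × Euc m → ℝ} (hf : ContDiff ℝ 2 f) (hg : ∀ i, ContDiff ℝ 2 (g i))
    {x : Euc n} {y : Euc m} {u : Euc q} (hmem : (y, u) ∈ DSet f g x)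
    (hA1 : A1m f g x y u) (hA2 : A2m f g x y u) (w : (Fin m → ℝ) × (Fin q → ℝ))
    (hw : ((x, y, u), w) ∈ signedMultipliers f g) : w = 0 := by
  obtain ⟨-, hD⟩ := hmem
  obtain ⟨β, γ⟩ := w
  obtain ⟨h1, h2⟩ := hw
  simp only at hD h1 h2
  let H : Matrix (Fin m) (Fin m) ℝ := Matrix.of fun k l => gradYL f g x y u l k
  let J : Matrix (Fin q) (Fin m) ℝ := Matrix.of fun i l => gradY (g i) x y l
  have hJ : ∀ (b : Fin m → ℝ) i, J.mulVec b i = ∑ l, b l * gradY (g i) x y l := fun b i => by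
    simp [J, Matrix.mulVec, dotProduct, mul_comm]
  have hHJ : ∀ (b : Fin m → ℝ) (c : Fin q → ℝ), H.mulVec b + J.transpose.mulVec c = 0 ↔
      (∑ l, b l • gradYL f g x y u l) + (∑ i, c i • gradY (g i) x y) = 0 := fun b c => by
    simp [H, J, funext_iff, PiLp.ext_iff, Matrix.mulVec, dotProduct, mul_comm]
  have hquad := sum_mul_mulVec_neg_of_isSymm H (by ext k l; exact gradYL_symm hf hg x y u k l) J
    (Finset.univ.filter fun i => u i = 0 ∧ g i (x, y) = 0)
    (Finset.univ.filter fun i => 0 < u i ∧ g i (x, y) = 0)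
    (by
      rw [Finset.disjoint_left]
      intro i hi hi'
      simp only [Finset.mem_filter, Finset.mem_univ, true_and] at hi hi'
      exact hi'.1.ne' hi.1)
    (by
      intro b c e1 e2 e3 e4
      simp only [Finset.mem_filter, Finset.mem_univ, true_and, hJ] at e2 e3 e4
      rw [hHJ] at e1
      have hrest : ∀ i, u i = 0 ∧ g i (x, y) < 0 → c i = 0 := fun i hi =>
        e3 i (fun h => hi.2.ne h.2) (fun h => hi.2.ne h.2)
      have hX := hA2 (b, c) ⟨by rw [zero_add]; exact e1, e2, hrest, e4⟩
      refine hA1 (b, c) ⟨?_, e2, hrest, e4⟩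
      rw [zero_add]
      refine Prod.ext ?_ ?_
      · simpa [Prod.fst_sum] using hX
      · simpa [Prod.snd_sum] using e1)
    β γ ((hHJ β γ).2 h1)
    (by
      intro i hi
      simp only [Finset.mem_filter, Finset.mem_univ, true_and] at hi
      have := (h2 i).1
      rw [hi.2, mul_zero, add_zero] at this
      rw [hJ]
      exact (mul_eq_zero.1 this).resolve_right hi.1.ne')
    (by
      intro i hi hi'
      simp only [Finset.mem_filter, Finset.mem_univ, true_and] at hi hi'
      have := (h2 i).1
      obtain ⟨hu, -, hug⟩ := hD i
      by_cases hg0 : g i (x, y) = 0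
      · rcases hu.eq_or_lt with h | h
        · exact absurd ⟨h.symm, hg0⟩ hi
        · exact absurd ⟨h, hg0⟩ hi'
      · rw [(mul_eq_zero.1 hug).resolve_right hg0, mul_zero, zero_add] at this
        exact (mul_eq_zero.1 this).resolve_right hg0)
  rcases hquad with ⟨hb, hc⟩ | hlt
  · exact Prod.ext hb hc
  · refine absurd hlt (not_lt.2 (Finset.sum_nonneg fun i _ => ?_))
    rw [hJ]
    exact (h2 i).2

/-- near `(xb, (yb, ub))`, for all small `t > 0`, upper-level regularity
and the qualification condition (CQ1) for the relaxed problem hold. -/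
theorem stmt_14 {n m p q : ℕ} (hn : 0 < n) (hm : 0 < m) (hp : 0 < p) (hq : 0 < q)
    (f : Euc n × Euc m → ℝ) (g : Fin q → Euc n × Euc m → ℝ) (G : Fin p → Euc n → ℝ)
    (hf : ContDiff ℝ 2 f) (hg : ∀ i, ContDiff ℝ 2 (g i)) (hG : ∀ j, ContDiff ℝ 1 (G j))
    (xb : Euc n) (yb : Euc m) (ub : Euc q)
    (hreg : UpperLevelRegular G xb) (hmem : (yb, ub) ∈ DSet f g xb)
    (hA1 : A1m f g xb yb ub) (hA2 : A2m f g xb yb ub) :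
    ∃ U ∈ 𝓝 xb, ∃ V ∈ 𝓝 ((yb, ub) : Euc m × Euc q), ∃ α₀ > 0,
      ∀ t : ℝ, 0 < t → t < α₀ → ∀ x ∈ U ∩ upperX G, ∀ z ∈ V ∩ DtSet f g t x,
        UpperLevelRegular G x ∧
        (∀ (β : Fin m → ℝ) (γ δ μ : Fin q → ℝ),
          ((∑ l, β l • gradYL f g x z.1 z.2 l)
            + (∑ i, (γ i - δ i * z.2 i) • gradY (g i) x z.1) = 0) →
          (∀ i, (∑ l, β l * gradY (g i) x z.1 l) - μ i - δ i * g i (x, z.1) = 0) →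
          (∀ i, 0 ≤ γ i) → (∀ i, 0 ≤ δ i) → (∀ i, 0 ≤ μ i) →
          (∀ i, μ i * z.2 i = 0) → (∀ i, γ i * g i (x, z.1) = 0) →
          (∀ i, δ i * (z.2 i * g i (x, z.1) + t) = 0) →
          β = 0 ∧ γ = 0 ∧ δ = 0 ∧ μ = 0) := by
  obtain ⟨U₂, hU₂, V, hV, hUV⟩ := mem_nhds_prod_iff.1 <|
    eventually_cone_trivial (isClosed_signedMultipliers hf hg)
      (fun s w c _ h => smul_mem_signedMultipliers s w c h) (xb, yb, ub)
      (signedMultipliers_trivial hf hg hmem hA1 hA2)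
  refine ⟨_, inter_mem (hreg.eventually hG) hU₂, V, hV, 1, one_pos, ?_⟩
  rintro t ht - x ⟨⟨hx, hxU⟩, -⟩ z ⟨hzV, -⟩
  refine ⟨hx, fun β γ δ μ h1 h2 hγ hδ hμ hμu hγg hδt => ?_⟩
  have hξ : ∀ i, ∑ l, β l * gradY (g i) x z.1 l = μ i + δ i * g i (x, z.1) := fun i => by
    linarith [h2 i]
  have hz : (β, fun i => γ i - δ i * z.2 i) = 0 := by
    refine hUV (mk_mem_prod hxU hzV) _ ⟨h1, fun i => ?_⟩
    simp only [hξ]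
    constructor
    · linear_combination hμu i + hγg i
    · have key : (γ i - δ i * z.2 i) * (μ i + δ i * g i (x, z.1)) = γ i * μ i + δ i ^ 2 * t := by
        linear_combination δ i * hγg i - δ i * hμu i - δ i * hδt i
      rw [key]
      have := mul_nonneg (hγ i) (hμ i)
      positivity
  rw [Prod.mk_eq_zero] at hz
  obtain ⟨rfl, hζ⟩ := hz
  have hζ' : ∀ i, γ i = δ i * z.2 i := fun i => sub_eq_zero.1 (congrFun hζ i)
  have hξ' : ∀ i, μ i + δ i * g i (x, z.1) = 0 := fun i => by rw [← hξ i]; simp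
  have hδ0 : ∀ i, δ i = 0 := fun i => by
    have : δ i ^ 2 * t = 0 := by
      linear_combination δ i * hδt i - δ i * z.2 i * hξ' i + δ i * hμu i
    simpa [ht.ne'] using this
  refine ⟨rfl, funext fun i => ?_, funext hδ0, funext fun i => ?_⟩
  · rw [hζ' i, hδ0 i, zero_mul, Pi.zero_apply]
  · simpa [hδ0 i] using hξ' i

end
end
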